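/- arXiv:1801.08745 — 3 statements merged into one kernel-verified Lean document; each statement's English description precedes it below -/
import Mathlib

section
/- Fix integers T, d, ℓ ≥ 1 and let μ be a 2^{−Tℓ}-measure on [0,1)^d. Then there exists a 2^{−Tℓ}-set X, contained in the dyadic support supp_d(μ), satisfying μ(X) ≥ (2Td+2)^{−ℓ}, such that the normalized restriction μ_X is σ-regular for some sequence σ ∈ [−1, d−1]^ℓ. -/
open MeasureTheory
open scoped ENNReal NNReal

/-- The half-open dyadic cube of side length `2⁻ⁿ` in `ℝ^d` indexed by `k ∈ ℤ^d`. -/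
def dyadicCube (d n : ℕ) (k : Fin d → ℤ) : Set (EuclideanSpace ℝ (Fin d)) :=
  {x | ∀ i, (k i : ℝ) / 2 ^ n ≤ x i ∧ x i < ((k i : ℝ) + 1) / 2 ^ n}

/-- A `2⁻ᵐ`-measure: a Borel probability measure on `[0,1)^d` whose restriction to each
dyadic cube of side length `2⁻ᵐ` is a multiple of Lebesgue measure. -/
def IsDyadicMeasure (d m : ℕ) (μ : Measure (EuclideanSpace ℝ (Fin d))) : Prop :=
  IsProbabilityMeasure μ ∧
  μ {x : EuclideanSpace ℝ (Fin d) | ∀ i, 0 ≤ x i ∧ x i < 1}ᶜ = 0 ∧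
  ∀ k : Fin d → ℤ, ∃ c : ℝ≥0∞,
    μ.restrict (dyadicCube d m k) = c • volume.restrict (dyadicCube d m k)

/-- A `σ`-regular measure (for `σ = (σ_1, …, σ_ℓ)`): a `2^{-Tℓ}`-measure such that for every
dyadic cube `Q` of side `2^{-jT}` (`1 ≤ j ≤ ℓ`) of positive measure,
`ν(Q) ≤ 2^{-T(σ_j+1)} ν(Q̂) ≤ 2 ν(Q)`, where `Q̂` is the parent cube of side `2^{-(j-1)T}`. -/
def IsRegularMeasure (d T ℓ : ℕ) (σ : ℕ → ℝ) (ν : Measure (EuclideanSpace ℝ (Fin d))) : Prop :=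
  IsDyadicMeasure d (T * ℓ) ν ∧
  ∀ j, 1 ≤ j → j ≤ ℓ → ∀ k : Fin d → ℤ,
    0 < ν (dyadicCube d (T * j) k) →
      ν (dyadicCube d (T * j) k) ≤
        ENNReal.ofReal ((2 : ℝ) ^ (-(T : ℝ) * (σ j + 1))) *
          ν (dyadicCube d (T * (j - 1)) fun i => (k i).fdiv (2 ^ T)) ∧
      ENNReal.ofReal ((2 : ℝ) ^ (-(T : ℝ) * (σ j + 1))) *
          ν (dyadicCube d (T * (j - 1)) fun i => (k i).fdiv (2 ^ T)) ≤
        2 * ν (dyadicCube d (T * j) k)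

/-- The dyadic support of `μ`: the points all of whose dyadic cubes (of sides `2^{-jT}`,
`j ∈ ℕ`) have positive measure. -/
def dyadicSupport (d T : ℕ) (μ : Measure (EuclideanSpace ℝ (Fin d))) :
    Set (EuclideanSpace ℝ (Fin d)) :=
  {x | ∀ j : ℕ, 0 < μ (dyadicCube d (T * j) fun i => ⌊x i * 2 ^ (T * j)⌋)}

/-- A finite family `S` of weights in which every weight lies between `(2κ)⁻¹` and `κ⁻¹` times
the total weight. -/
def IsBalanced {α : Type*} (a : α → ℝ) (κ : ℝ) (S : Finset α) : Prop :=
  ∀ q ∈ S, κ * a q ≤ ∑ x ∈ S, a x ∧ ∑ x ∈ S, a x ≤ 2 * (κ * a q)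

/-- A family of weights in a window `[s κ / (2κ - 1), s]` of total weight at least `κ s` has a
balanced subfamily of total weight at least `κ s`. -/
theorem exists_isBalanced_subset {α : Type*} [DecidableEq α] {a : α → ℝ} {κ s : ℝ} (hκ : 0 ≤ κ)
    {B : Finset α} (hle : ∀ q ∈ B, a q ≤ s) (hlow : ∀ q ∈ B, κ * s ≤ (2 * κ - 1) * a q)
    (hsum : κ * s ≤ ∑ x ∈ B, a x) :
    ∃ S ⊆ B, κ * s ≤ ∑ x ∈ S, a x ∧ IsBalanced a κ S := by
  obtain ⟨S, hS, hmin⟩ := Finset.exists_min_image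
    (B.powerset.filter fun S => κ * s ≤ ∑ x ∈ S, a x) Finset.card
    ⟨B, by simp [hsum]⟩
  simp only [Finset.mem_filter, Finset.mem_powerset] at hS hmin
  refine ⟨S, hS.1, hS.2, fun q hq => ⟨?_, ?_⟩⟩
  · exact (mul_le_mul_of_nonneg_left (hle q (hS.1 hq)) hκ).trans hS.2
  · have h1 : ∑ x ∈ S.erase q, a x < κ * s := by
      by_contra! h
      have h2 := hmin (S.erase q) ⟨(Finset.erase_subset _ _).trans hS.1, h⟩
      exact absurd (Finset.card_erase_lt_of_mem hq) (not_lt.mpr h2)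
    have h2 := Finset.add_sum_erase S a hq
    have h3 := hlow q (hS.1 hq)
    linarith

/-- If all balanced subfamilies of `C` at scale `2 ^ k` have total weight at most `f k`, then any
subfamily of weights bounded by `s` has total weight at most
`6 s + 2 ∑ k, min (f k) (2 ^ k * s)`. -/
theorem sum_le_of_isBalanced_le {α : Type*} [DecidableEq α] {a : α → ℝ} (ha : ∀ q, 0 ≤ a q)
    {C : Finset α} {D : ℕ} (hD : 2 ≤ D) (hC : C.card ≤ 2 ^ D) {f : ℕ → ℝ}
    (hf : ∀ k, ∀ S ⊆ C, IsBalanced a (2 ^ k) S → ∑ x ∈ S, a x ≤ f k)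
    (B : Finset α) (hB : B ⊆ C) (s : ℝ) (hs : 0 ≤ s) (hBs : ∀ q ∈ B, a q ≤ s) :
    ∑ x ∈ B, a x ≤ 6 * s + ∑ k ∈ Finset.Ico 1 (D - 1), 2 * min (f k) (2 ^ k * s) := by
  induction B using Finset.strongInduction generalizing s with
  | H B ih =>
  have hf0 : ∀ k, 0 ≤ f k := fun k => by
    simpa using hf k ∅ (Finset.empty_subset _) (by simp [IsBalanced])
  rcases B.eq_empty_or_nonempty with rfl | hne
  · rw [Finset.sum_empty]
    have : 0 ≤ ∑ k ∈ Finset.Ico 1 (D - 1), 2 * min (f k) (2 ^ k * s) :=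
      Finset.sum_nonneg fun k _ => mul_nonneg zero_le_two (le_min (hf0 k) (by positivity))
    linarith
  obtain ⟨z, hz, hzmax⟩ := Finset.exists_max_image B a hne
  have hmono : ∀ u v : ℝ, u ≤ v → ∀ k : ℕ, min (f k) (2 ^ k * u) ≤ min (f k) (2 ^ k * v) :=
    fun u v huv k => min_le_min le_rfl (mul_le_mul_of_nonneg_left huv (by positivity))
  suffices h : ∑ x ∈ B, a x ≤
      6 * a z + ∑ k ∈ Finset.Ico 1 (D - 1), 2 * min (f k) (2 ^ k * a z) by
    refine h.trans (add_le_add (by linarith [hBs z hz]) (Finset.sum_le_sum fun k _ => ?_))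
    linarith [hmono (a z) s (hBs z hz) k]
  set t := a z with ht
  have ht0 : 0 ≤ t := ha z
  have hgeom : ∀ j, 1 ≤ j → ∑ k ∈ Finset.Ico 1 j, (2 : ℝ) * 2 ^ k = 2 * 2 ^ j - 4 := by
    intro j hj
    induction j, hj using Nat.le_induction with
    | base => norm_num
    | succ n hn ihn => rw [Finset.sum_Ico_succ_top hn, ihn]; ring
  by_cases hj : ∃ j, j ∈ Finset.Ico 1 (D - 1) ∧ f j < 2 ^ j * t
  · classical
    obtain ⟨hj1, hj2⟩ := Nat.find_spec hj
    have hj3 := fun i => Nat.find_min hj (m := i)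
    set j := Nat.find hj
    rw [Finset.mem_Ico] at hj1
    set κ : ℝ := 2 ^ j with hκ
    have hκ2 : (2 : ℝ) ≤ κ := by
      calc (2 : ℝ) = 2 ^ 1 := by norm_num
        _ ≤ 2 ^ j := pow_le_pow_right₀ (by norm_num) hj1.1
    have htpos : 0 < t := by
      rcases ht0.eq_or_lt with h | h
      · rw [← h, mul_zero] at hj2
        exact absurd hj2 (not_lt.mpr (hf0 j))
      · exact h
    have hρ : (0 : ℝ) < 2 * κ - 1 := by linarith
    set u : ℝ := κ * t / (2 * κ - 1) with hu
    have hu0 : 0 ≤ u := by positivity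
    have hue : (2 * κ - 1) * u = κ * t := by rw [hu]; field_simp
    have hut : u < t := by
      rw [hu, div_lt_iff₀ hρ]
      nlinarith
    have hsmall := ih (B.filter fun q => a q ≤ u)
      (Finset.filter_ssubset.mpr ⟨z, hz, not_le.mpr hut⟩)
      ((Finset.filter_subset _ _).trans hB) u hu0 (by simp)
    have hlarge : ∑ x ∈ B.filter (fun q => ¬ a q ≤ u), a x < κ * t := by
      by_contra! h
      obtain ⟨S, hS1, hS2, hS3⟩ := exists_isBalanced_subset (κ := κ) (s := t) (by linarith)
        (fun q hq => hzmax q (Finset.mem_filter.mp hq).1)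
        (fun q hq => by
          have : u < a q := by simpa using (Finset.mem_filter.mp hq).2
          rw [← hue]
          exact mul_le_mul_of_nonneg_left this.le hρ.le) h
      have := hf j S (hS1.trans ((Finset.filter_subset _ _).trans hB)) hS3
      linarith
    rw [← Finset.sum_filter_add_sum_filter_not B (fun q => a q ≤ u)]
    have hsplit : ∀ v : ℝ, ∑ k ∈ Finset.Ico 1 (D - 1), 2 * min (f k) (2 ^ k * v) =
        ∑ k ∈ Finset.Ico 1 j, 2 * min (f k) (2 ^ k * v) +
        ∑ k ∈ Finset.Ico j (D - 1), 2 * min (f k) (2 ^ k * v) := fun v =>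
      (Finset.sum_Ico_consecutive _ hj1.1 hj1.2.le).symm
    have hlow : ∀ v : ℝ, v ≤ t → ∑ k ∈ Finset.Ico 1 j, 2 * min (f k) (2 ^ k * v) =
        (2 * κ - 4) * v := by
      intro v hv
      rw [← hgeom j hj1.1, Finset.sum_mul]
      refine Finset.sum_congr rfl fun k hk => ?_
      rw [Finset.mem_Ico] at hk
      have h1 : ¬ f k < 2 ^ k * t := fun h =>
        hj3 k hk.2 ⟨Finset.mem_Ico.mpr ⟨hk.1, hk.2.trans hj1.2⟩, h⟩
      rw [min_eq_right, mul_assoc]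
      exact (mul_le_mul_of_nonneg_left hv (by positivity)).trans (not_lt.mp h1)
    have hhigh : ∑ k ∈ Finset.Ico j (D - 1), 2 * min (f k) (2 ^ k * u) ≤
        ∑ k ∈ Finset.Ico j (D - 1), 2 * min (f k) (2 ^ k * t) :=
      Finset.sum_le_sum fun k _ => by linarith [hmono u t hut.le k]
    rw [hsplit, hlow u hut.le] at hsmall
    rw [hsplit, hlow t le_rfl]
    have hkey : κ * t ≤ (2 * κ + 2) * (t - u) := by
      have h1 : t - u = (κ - 1) * t / (2 * κ - 1) := by
        rw [eq_div_iff hρ.ne']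
        linarith
      rw [h1, ← mul_div_assoc, le_div_iff₀ hρ]
      nlinarith
    linarith
  · push Not at hj
    have h1 : ∑ k ∈ Finset.Ico 1 (D - 1), 2 * min (f k) (2 ^ k * t) =
        (2 * 2 ^ (D - 1) - 4) * t := by
      rw [← hgeom (D - 1) (by omega), Finset.sum_mul]
      exact Finset.sum_congr rfl fun k hk => by rw [min_eq_right (hj k hk), mul_assoc]
    have h2 : (2 : ℝ) * 2 ^ (D - 1) = 2 ^ D := by
      rw [← pow_succ', Nat.sub_add_cancel (by omega)]
    have h3 : ∑ x ∈ B, a x ≤ B.card * t := by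
      simpa using Finset.sum_le_card_nsmul B a t hzmax
    have h4 : (B.card : ℝ) ≤ 2 ^ D := by
      exact_mod_cast (Finset.card_le_card hB).trans hC
    rw [h1, h2]
    nlinarith [mul_le_mul_of_nonneg_right h4 ht0]

/-- Among at most `2 ^ D` weights, balanced subfamilies at the scales `2 ^ k`, `k ≤ D`, carry the
total weight up to multiplicities `w k` that depend only on `D` and add up to at most
`2 * D + 2`. -/
theorem exists_weights_sum_le (α : Type*) [DecidableEq α] {D : ℕ} (hD : 1 ≤ D) :
    ∃ w : ℕ → ℝ, (∀ k, 0 ≤ w k) ∧ ∑ k ∈ Finset.range (D + 1), w k ≤ 2 * D + 2 ∧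
      ∀ (a : α → ℝ) (C : Finset α) (f : ℕ → ℝ), (∀ q, 0 ≤ a q) → C.card ≤ 2 ^ D →
        (∀ k, ∀ S ⊆ C, IsBalanced a (2 ^ k) S → ∑ x ∈ S, a x ≤ f k) →
        ∑ x ∈ C, a x ≤ ∑ k ∈ Finset.range (D + 1), w k * f k := by
  have hmax : ∀ (a : α → ℝ) (C : Finset α) (f : ℕ → ℝ), (∀ q, 0 ≤ a q) →
      (∀ k, ∀ S ⊆ C, IsBalanced a (2 ^ k) S → ∑ x ∈ S, a x ≤ f k) → ∀ q ∈ C, a q ≤ f 0 := by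
    intro a C f ha hf q hq
    simpa using hf 0 {q} (by simpa using hq) (by simp [IsBalanced]; linarith [ha q])
  have hnonneg : ∀ (a : α → ℝ) (C : Finset α) (f : ℕ → ℝ),
      (∀ k, ∀ S ⊆ C, IsBalanced a (2 ^ k) S → ∑ x ∈ S, a x ≤ f k) → 0 ≤ f 0 := by
    intro a C f hf
    simpa using hf 0 ∅ (Finset.empty_subset _) (by simp [IsBalanced])
  rcases hD.eq_or_lt with rfl | hD2
  · refine ⟨fun k => if k = 0 then 2 else 0, fun k => by positivity, by norm_num, ?_⟩
    intro a C f ha hC hf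
    have h1 : ∑ x ∈ C, a x ≤ C.card * f 0 := by
      simpa using Finset.sum_le_card_nsmul C a (f 0) (hmax a C f ha hf)
    have h2 : (C.card : ℝ) ≤ 2 := by exact_mod_cast hC
    simp only [ite_mul, zero_mul]
    rw [Finset.sum_ite_eq' (Finset.range (1 + 1)) 0]
    simp only [Finset.mem_range, Nat.succ_pos, if_true]
    nlinarith [hnonneg a C f hf]
  · have hsub : Finset.Ico 1 (D - 1) ⊆ Finset.range (D + 1) := fun k hk => by
      simp only [Finset.mem_Ico, Finset.mem_range] at hk ⊢
      omega
    refine ⟨fun k => (if k = 0 then 6 else 0) + if k ∈ Finset.Ico 1 (D - 1) then 2 else 0,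
      fun k => by positivity, ?_, ?_⟩
    · rw [Finset.sum_add_distrib, Finset.sum_ite_eq' (Finset.range (D + 1)) 0,
        Finset.sum_ite_mem, Finset.inter_eq_right.mpr hsub]
      obtain ⟨n, rfl⟩ : ∃ n, D = n + 2 := ⟨D - 2, by omega⟩
      simp
      linarith
    · intro a C f ha hC hf
      have h := sum_le_of_isBalanced_le ha hD2 hC hf C le_rfl (f 0) (hnonneg a C f hf)
        (hmax a C f ha hf)
      simp only [add_mul, ite_mul, zero_mul]
      rw [Finset.sum_add_distrib, Finset.sum_ite_eq' (Finset.range (D + 1)) 0,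
        Finset.sum_ite_mem, Finset.inter_eq_right.mpr hsub]
      simp only [Finset.mem_range, Nat.succ_pos, if_true]
      refine h.trans (add_le_add le_rfl (Finset.sum_le_sum fun k _ => ?_))
      linarith [min_le_left (f k) (2 ^ k * f 0)]

/-- One scale of the regularization: a weighted family whose fibres under `π` have at most `2 ^ D`
elements contains a subfamily, balanced in each fibre at a common scale, that carries a proportion
`1 / (2 * D + 2)` of the total weight. -/
theorem exists_isBalanced_fibers {α β : Type*} [DecidableEq α] [DecidableEq β] {D : ℕ}
    (hD : 1 ≤ D) (π : α → β) {a : α → ℝ} (ha : ∀ q, 0 ≤ a q) (Q : Finset α)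
    (hπ : ∀ r, (Q.filter fun q => π q = r).card ≤ 2 ^ D) :
    ∃ k ≤ D, ∃ S ⊆ Q, ∑ x ∈ Q, a x ≤ (2 * D + 2) * ∑ x ∈ S, a x ∧
      ∀ r, IsBalanced a (2 ^ k) (S.filter fun q => π q = r) := by
  classical
  obtain ⟨w, hw0, hw, hsum⟩ := exists_weights_sum_le α hD
  have hex : ∀ (k : ℕ) (r : β), ∃ S ⊆ Q.filter (fun q => π q = r), IsBalanced a (2 ^ k) S ∧
      ∀ S' ⊆ Q.filter (fun q => π q = r), IsBalanced a (2 ^ k) S' →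
        ∑ x ∈ S', a x ≤ ∑ x ∈ S, a x := by
    intro k r
    obtain ⟨S, hS, hmax⟩ := Finset.exists_max_image
      ((Q.filter fun q => π q = r).powerset.filter fun S => IsBalanced a (2 ^ k) S)
      (fun S => ∑ x ∈ S, a x) ⟨∅, Finset.mem_filter.mpr ⟨by simp, by simp [IsBalanced]⟩⟩
    rw [Finset.mem_filter, Finset.mem_powerset] at hS
    exact ⟨S, hS.1, hS.2, fun S' h1 h2 =>
      hmax S' (Finset.mem_filter.mpr ⟨Finset.mem_powerset.mpr h1, h2⟩)⟩
  choose S hSsub hSbal hSmax using hex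
  set U : ℕ → Finset α := fun k => Q.filter fun q => q ∈ S k (π q) with hU
  have hfib : ∀ k r, (U k).filter (fun q => π q = r) = S k r := by
    intro k r
    ext q
    simp only [hU, Finset.mem_filter]
    constructor
    · rintro ⟨⟨_, h⟩, rfl⟩
      exact h
    · intro h
      have h' := Finset.mem_filter.mp (hSsub k r h)
      exact ⟨⟨h'.1, by rw [h'.2]; exact h⟩, h'.2⟩
  have hUsum : ∀ k, ∑ r ∈ Q.image π, ∑ x ∈ S k r, a x = ∑ x ∈ U k, a x := by
    intro k
    rw [← Finset.sum_fiberwise_of_maps_to (s := U k) (t := Q.image π) (g := π) (fun q hq =>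
      Finset.mem_image_of_mem _ (Finset.mem_filter.mp hq).1)]
    simp only [hfib]
  obtain ⟨k, hk, hkmax⟩ := Finset.exists_max_image (Finset.range (D + 1))
    (fun k => ∑ x ∈ U k, a x) ⟨0, by simp⟩
  refine ⟨k, by simpa [Nat.lt_succ_iff] using hk, U k, Finset.filter_subset _ _, ?_, fun r => ?_⟩
  · calc ∑ x ∈ Q, a x = ∑ r ∈ Q.image π, ∑ x ∈ Q.filter (fun q => π q = r), a x :=
          (Finset.sum_fiberwise_of_maps_to (fun q hq => Finset.mem_image_of_mem _ hq) _).symm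
      _ ≤ ∑ r ∈ Q.image π, ∑ i ∈ Finset.range (D + 1), w i * ∑ x ∈ S i r, a x :=
          Finset.sum_le_sum fun r _ => hsum a _ (fun i => ∑ x ∈ S i r, a x) ha (hπ r)
            fun i S' h1 h2 => hSmax i r S' h1 h2
      _ = ∑ i ∈ Finset.range (D + 1), w i * ∑ x ∈ U i, a x := by
          rw [Finset.sum_comm]
          exact Finset.sum_congr rfl fun i _ => by rw [← Finset.mul_sum, hUsum]
      _ ≤ ∑ i ∈ Finset.range (D + 1), w i * ∑ x ∈ U k, a x :=
          Finset.sum_le_sum fun i hi => mul_le_mul_of_nonneg_left (hkmax i hi) (hw0 i)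
      _ = (∑ i ∈ Finset.range (D + 1), w i) * ∑ x ∈ U k, a x := (Finset.sum_mul _ _ _).symm
      _ ≤ (2 * D + 2) * ∑ x ∈ U k, a x :=
          mul_le_mul_of_nonneg_right hw (Finset.sum_nonneg fun x _ => ha x)
  · rw [hfib]
    exact hSbal k r

/-- Regularization of a weighted finite tree of height `ℓ` with branching at most `2 ^ D`, where
`p j x` is the ancestor of the leaf `x` at level `j` and `π` is the parent map. -/
theorem exists_regular_subtree {α : Type*} [DecidableEq α] {D : ℕ} (hD : 1 ≤ D) (ℓ : ℕ)
    (p : ℕ → α → α) (π : α → α) (hp : ∀ j < ℓ, ∀ x, p j x = π (p (j + 1) x))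
    (hπ : ∀ r, ∀ Q : Finset α, (∀ q ∈ Q, π q = r) → Q.card ≤ 2 ^ D)
    {m : α → ℝ} (hm : ∀ x, 0 ≤ m x) (K₀ : Finset α) :
    ∃ K ⊆ K₀, ∃ e : ℕ → ℕ, (∀ j, e j ≤ D) ∧
      ∑ x ∈ K₀, m x ≤ (2 * D + 2) ^ ℓ * ∑ x ∈ K, m x ∧
      ∀ j < ℓ, ∀ q, 0 < ∑ x ∈ K.filter (fun x => p (j + 1) x = q), m x →
        2 ^ e j * ∑ x ∈ K.filter (fun x => p (j + 1) x = q), m x ≤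
          ∑ x ∈ K.filter (fun x => p j x = π q), m x ∧
        ∑ x ∈ K.filter (fun x => p j x = π q), m x ≤
          2 * (2 ^ e j * ∑ x ∈ K.filter (fun x => p (j + 1) x = q), m x) := by
  have hanc : ∀ i j, i ≤ j → j ≤ ℓ → ∀ x y, p j x = p j y → p i x = p i y := by
    intro i j hij
    induction j, hij using Nat.le_induction with
    | base => exact fun _ _ _ h => h
    | succ j hij ih =>
      intro hj x y h
      exact ih (by omega) x y (by rw [hp j hj, hp j hj, h])
  suffices h : ∀ n ≤ ℓ, ∃ K ⊆ K₀, ∃ e : ℕ → ℕ, (∀ j, e j ≤ D) ∧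
      ∑ x ∈ K₀, m x ≤ (2 * D + 2) ^ n * ∑ x ∈ K, m x ∧
      ∀ j < ℓ, ℓ - n ≤ j → ∀ q, 0 < ∑ x ∈ K.filter (fun x => p (j + 1) x = q), m x →
        2 ^ e j * ∑ x ∈ K.filter (fun x => p (j + 1) x = q), m x ≤
          ∑ x ∈ K.filter (fun x => p j x = π q), m x ∧
        ∑ x ∈ K.filter (fun x => p j x = π q), m x ≤
          2 * (2 ^ e j * ∑ x ∈ K.filter (fun x => p (j + 1) x = q), m x) by
    obtain ⟨K, hK, e, he, hs, hr⟩ := h ℓ le_rfl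
    exact ⟨K, hK, e, he, hs, fun j hj q => hr j hj (by omega) q⟩
  intro n
  induction n with
  | zero =>
    exact fun _ => ⟨K₀, le_rfl, fun _ => 0, by simp, by simp, fun j hj hj' => by omega⟩
  | succ n ih =>
    intro hn
    obtain ⟨K, hK, e, he, hs, hr⟩ := ih (by omega)
    obtain ⟨i, hi⟩ : ∃ i, i + 1 + n = ℓ := ⟨ℓ - n - 1, by omega⟩
    set a : α → ℝ := fun q => ∑ x ∈ K.filter (fun x => p (i + 1) x = q), m x with ha
    obtain ⟨k, hk, S, hS, hSsum, hSbal⟩ := exists_isBalanced_fibers hD π (a := a)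
      (fun q => Finset.sum_nonneg fun x _ => hm x) (K.image (p (i + 1)))
      (fun r => hπ r _ fun q hq => (Finset.mem_filter.mp hq).2)
    set K' := K.filter fun x => p (i + 1) x ∈ S with hK'
    have hsame : ∀ j, i + 1 ≤ j → j ≤ ℓ → ∀ y ∈ K', K'.filter (fun x => p j x = p j y) =
        K.filter fun x => p j x = p j y := by
      intro j hj hjℓ y hy
      ext x
      simp only [hK', Finset.mem_filter]
      refine ⟨fun h => ⟨h.1.1, h.2⟩, fun h => ⟨⟨h.1, ?_⟩, h.2⟩⟩
      rw [hanc _ _ hj hjℓ x y h.2]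
      exact (Finset.mem_filter.mp hy).2
    have hrep : ∀ j q, 0 < ∑ x ∈ K'.filter (fun x => p j x = q), m x → ∃ y ∈ K', p j y = q := by
      intro j q h
      obtain ⟨y, hy, _⟩ := Finset.exists_ne_zero_of_sum_ne_zero h.ne'
      exact ⟨y, (Finset.mem_filter.mp hy).1, (Finset.mem_filter.mp hy).2⟩
    have hsumS : ∀ R : Finset α, ∑ x ∈ K.filter (fun x => p (i + 1) x ∈ R), m x =
        ∑ q ∈ R, a q := by
      intro R
      rw [← Finset.sum_fiberwise_of_maps_to (s := K.filter fun x => p (i + 1) x ∈ R) (t := R)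
        (g := p (i + 1)) (fun x hx => (Finset.mem_filter.mp hx).2)]
      refine Finset.sum_congr rfl fun q hq => Finset.sum_congr ?_ fun _ _ => rfl
      ext x
      simp only [Finset.mem_filter]
      refine ⟨fun h => ⟨h.1.1, h.2⟩, fun h => ⟨⟨h.1, by rw [h.2]; exact hq⟩, h.2⟩⟩
    refine ⟨K', (Finset.filter_subset _ _).trans hK, Function.update e i k, ?_, ?_, ?_⟩
    · intro j
      rcases eq_or_ne j i with rfl | hji
      · simpa using hk
      · simpa [Function.update_of_ne hji] using he j
    · have h1 : ∑ x ∈ K, m x = ∑ q ∈ K.image (p (i + 1)), a q := by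
        rw [← hsumS]
        refine Finset.sum_congr ?_ fun _ _ => rfl
        exact (Finset.filter_true_of_mem fun x hx => Finset.mem_image_of_mem _ hx).symm
      have h2 : ∑ x ∈ K', m x = ∑ q ∈ S, a q := hsumS S
      rw [← h1, ← h2] at hSsum
      calc _ ≤ _ := hs
        _ ≤ (2 * (D : ℝ) + 2) ^ n * ((2 * D + 2) * ∑ x ∈ K', m x) :=
          mul_le_mul_of_nonneg_left hSsum (by positivity)
        _ = _ := by ring
    · intro j hj hij q hq
      obtain ⟨y, hy, rfl⟩ := hrep _ _ hq
      rcases eq_or_ne j i with rfl | hji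
      · rw [Function.update_self, hsame _ le_rfl (by omega) y hy]
        have h1 : K'.filter (fun x => p j x = π (p (j + 1) y)) =
            K.filter fun x => p (j + 1) x ∈ S.filter fun q => π q = π (p (j + 1) y) := by
          ext x
          simp only [hK', Finset.mem_filter, hp j hj, and_assoc]
        rw [h1, hsumS]
        exact hSbal _ (p (j + 1) y)
          (Finset.mem_filter.mpr ⟨(Finset.mem_filter.mp hy).2, rfl⟩)
      · have h1 : i + 1 ≤ j := by omega
        rw [hsame _ (by omega) (by omega) y hy] at hq ⊢
        rw [Function.update_of_ne hji, ← hp j hj, hsame _ h1 hj.le y hy, hp j hj]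
        exact hr j hj (by omega) _ hq

theorem mem_dyadicCube_iff {d n : ℕ} {k : Fin d → ℤ} {x : EuclideanSpace ℝ (Fin d)} :
    x ∈ dyadicCube d n k ↔ ∀ i, ⌊x i * 2 ^ n⌋ = k i := by
  have h2 : (0 : ℝ) < 2 ^ n := by positivity
  simp only [dyadicCube, Set.mem_ofPred_eq, Int.floor_eq_iff, div_le_iff₀ h2, lt_div_iff₀ h2]

theorem measurableSet_dyadicCube (d n : ℕ) (k : Fin d → ℤ) : MeasurableSet (dyadicCube d n k) := by
  simp only [dyadicCube, Set.ofPred_forall, Set.ofPred_and]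
  exact MeasurableSet.iInter fun i =>
    (measurableSet_le measurable_const (by fun_prop)).inter
      (measurableSet_lt (by fun_prop) measurable_const)

theorem pairwiseDisjoint_dyadicCube (d n : ℕ) (K : Set (Fin d → ℤ)) :
    K.PairwiseDisjoint (dyadicCube d n) := by
  intro k _ k' _ hne
  refine Set.disjoint_left.mpr fun x hx hx' => hne (funext fun i => ?_)
  rw [← mem_dyadicCube_iff.mp hx i, mem_dyadicCube_iff.mp hx' i]

theorem volume_dyadicCube_pos (d n : ℕ) (k : Fin d → ℤ) : 0 < volume (dyadicCube d n k) := by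
  have hopen : IsOpen {x : EuclideanSpace ℝ (Fin d) |
      ∀ i, (k i : ℝ) / 2 ^ n < x i ∧ x i < ((k i : ℝ) + 1) / 2 ^ n} := by
    simp only [Set.ofPred_forall, Set.ofPred_and]
    exact isOpen_iInter_of_finite fun i =>
      (isOpen_lt continuous_const (by fun_prop)).inter (isOpen_lt (by fun_prop) continuous_const)
  refine (hopen.measure_pos volume ⟨WithLp.toLp 2 fun i => ((k i : ℝ) + 1 / 2) / 2 ^ n, ?_⟩).trans_le
    (measure_mono fun x hx i => ⟨(hx i).1.le, (hx i).2⟩)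
  intro i
  constructor
  · simp only
    gcongr
    linarith
  · simp only
    gcongr
    norm_num

theorem floor_mul_two_pow_ediv (y : ℝ) {n m : ℕ} (h : n ≤ m) :
    ⌊y * 2 ^ m⌋ / 2 ^ (m - n) = ⌊y * 2 ^ n⌋ := by
  obtain ⟨r, rfl⟩ := Nat.exists_eq_add_of_le h
  have h1 := Int.floor_div_natCast (y * 2 ^ (n + r)) (2 ^ r)
  have h2 : y * 2 ^ (n + r) / ((2 ^ r : ℕ) : ℝ) = y * 2 ^ n := by
    push_cast
    rw [pow_add, ← mul_assoc, mul_div_assoc, div_self (by positivity), mul_one]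
  rw [h2] at h1
  rw [h1, Nat.add_sub_cancel_left]
  push_cast
  rfl

/-- A dyadic cube of side `2⁻ᵐ` lies in its ancestor of side `2⁻ⁿ`. -/
theorem mem_dyadicCube_iff_ediv {d n m : ℕ} (h : n ≤ m) {k q : Fin d → ℤ}
    {x : EuclideanSpace ℝ (Fin d)} (hx : x ∈ dyadicCube d m k) :
    x ∈ dyadicCube d n q ↔ (fun i => k i / 2 ^ (m - n)) = q := by
  rw [mem_dyadicCube_iff, funext_iff]
  refine forall_congr' fun i => ?_
  rw [← mem_dyadicCube_iff.mp hx i, floor_mul_two_pow_ediv _ h]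

theorem biUnion_dyadicCube_inter {d n m : ℕ} (h : n ≤ m) (K : Finset (Fin d → ℤ))
    (q : Fin d → ℤ) :
    dyadicCube d n q ∩ ⋃ k ∈ K, dyadicCube d m k =
      ⋃ k ∈ K.filter (fun k => (fun i => k i / 2 ^ (m - n)) = q), dyadicCube d m k := by
  ext x
  simp only [Set.mem_inter_iff, Set.mem_iUnion, exists_prop, Finset.mem_filter]
  constructor
  · rintro ⟨hq, k, hk, hx⟩
    exact ⟨k, ⟨hk, (mem_dyadicCube_iff_ediv h hx).mp hq⟩, hx⟩
  · rintro ⟨k, ⟨hk, hkq⟩, hx⟩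
    exact ⟨(mem_dyadicCube_iff_ediv h hx).mpr hkq, k, hk, hx⟩

theorem measure_biUnion_dyadicCube {d m : ℕ} (μ : Measure (EuclideanSpace ℝ (Fin d)))
    [IsFiniteMeasure μ] (K : Finset (Fin d → ℤ)) :
    μ (⋃ k ∈ K, dyadicCube d m k) = ENNReal.ofReal (∑ k ∈ K, μ.real (dyadicCube d m k)) := by
  rw [measure_biUnion_finset (pairwiseDisjoint_dyadicCube d m _)
    fun k _ => measurableSet_dyadicCube d m k, ENNReal.ofReal_sum_of_nonneg
    fun _ _ => measureReal_nonneg]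
  exact Finset.sum_congr rfl fun k _ => (ENNReal.ofReal_toReal (measure_ne_top μ _)).symm

/-- Every child of a dyadic cube at generation distance `T` is one of at most `2 ^ (T * d)`. -/
theorem card_le_of_fdiv_eq {d T : ℕ} (r : Fin d → ℤ) (Q : Finset (Fin d → ℤ))
    (hQ : ∀ q ∈ Q, (fun i => (q i).fdiv (2 ^ T)) = r) : Q.card ≤ 2 ^ (T * d) := by
  have hpos : (0 : ℤ) < 2 ^ T := by positivity
  have hsub : Q ⊆ Fintype.piFinset fun i => Finset.Ico (r i * 2 ^ T) (r i * 2 ^ T + 2 ^ T) := by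
    intro q hq
    rw [Fintype.mem_piFinset]
    intro i
    have h1 := congrFun (hQ q hq) i
    simp only [Int.fdiv_eq_ediv_of_nonneg _ hpos.le] at h1
    have h2 := Int.mul_ediv_add_emod (q i) (2 ^ T)
    have h3 := Int.emod_nonneg (q i) hpos.ne'
    have h4 := Int.emod_lt_of_pos (q i) hpos
    rw [h1, mul_comm] at h2
    rw [Finset.mem_Ico]
    constructor <;> linarith
  refine (Finset.card_le_card hsub).trans ?_
  rw [Fintype.card_piFinset]
  simp only [Int.card_Ico, add_sub_cancel_left, Finset.prod_const, Finset.card_univ,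
    Fintype.card_fin, pow_mul]
  exact (congrArg (· ^ d) (Int.toNat_pow_of_nonneg (by norm_num) T)).le

/-- A cube of positive mass of a `2^{-Tℓ}`-measure lies in the dyadic support. -/
theorem dyadicCube_subset_dyadicSupport {d T ℓ : ℕ} {μ : Measure (EuclideanSpace ℝ (Fin d))}
    (hμ : IsDyadicMeasure d (T * ℓ) μ) {k : Fin d → ℤ} (hk : μ (dyadicCube d (T * ℓ) k) ≠ 0) :
    dyadicCube d (T * ℓ) k ⊆ dyadicSupport d T μ := by
  intro x hx j
  have hself : ∀ n, x ∈ dyadicCube d n fun i => ⌊x i * 2 ^ n⌋ := fun n =>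
    mem_dyadicCube_iff.mpr fun _ => rfl
  rcases le_total j ℓ with hj | hj
  · refine (pos_iff_ne_zero.mpr hk).trans_le (measure_mono fun y hy => ?_)
    have hle := Nat.mul_le_mul_left T hj
    exact (mem_dyadicCube_iff_ediv hle hy).mpr ((mem_dyadicCube_iff_ediv hle hx).mp (hself _))
  · have hle := Nat.mul_le_mul_left T hj
    obtain ⟨c, hc⟩ := hμ.2.2 k
    have hc0 : c ≠ 0 := by
      rintro rfl
      apply hk
      rw [← Measure.restrict_apply_self, hc]
      simp
    have hsub : (dyadicCube d (T * j) fun i => ⌊x i * 2 ^ (T * j)⌋) ⊆ dyadicCube d (T * ℓ) k := by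
      intro y hy
      exact (mem_dyadicCube_iff_ediv hle hy).mpr
        ((mem_dyadicCube_iff_ediv hle (hself _)).mp hx)
    rw [← Measure.restrict_eq_self μ hsub, hc, Measure.smul_apply, smul_eq_mul,
      Measure.restrict_eq_self _ hsub]
    exact ENNReal.mul_pos hc0 (volume_dyadicCube_pos _ _ _).ne'

/-- The normalized restriction of a `2⁻ᵐ`-measure to a `2⁻ᵐ`-set of positive measure is a
`2⁻ᵐ`-measure. -/
theorem IsDyadicMeasure.inv_smul_restrict {d m : ℕ} {μ : Measure (EuclideanSpace ℝ (Fin d))}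
    (hμ : IsDyadicMeasure d m μ) (K : Finset (Fin d → ℤ))
    (hK : μ (⋃ k ∈ K, dyadicCube d m k) ≠ 0) :
    IsDyadicMeasure d m ((μ (⋃ k ∈ K, dyadicCube d m k))⁻¹ •
      μ.restrict (⋃ k ∈ K, dyadicCube d m k)) := by
  have := hμ.1
  refine ⟨⟨?_⟩, ?_, fun k => ?_⟩
  · rw [Measure.smul_apply, Measure.restrict_apply_univ, smul_eq_mul,
      ENNReal.inv_mul_cancel hK (measure_ne_top _ _)]
  · rw [Measure.smul_apply, smul_eq_mul,
      le_antisymm ((Measure.restrict_apply_le _ _).trans hμ.2.1.le) zero_le, mul_zero]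
  · rw [Measure.restrict_smul, Measure.restrict_restrict (measurableSet_dyadicCube d m k)]
    by_cases hk : k ∈ K
    · obtain ⟨c, hc⟩ := hμ.2.2 k
      refine ⟨(μ (⋃ k ∈ K, dyadicCube d m k))⁻¹ * c, ?_⟩
      rw [Set.inter_eq_left.mpr (Finset.subset_set_biUnion_of_mem (f := dyadicCube d m) hk), hc, smul_smul]
    · refine ⟨0, ?_⟩
      have : dyadicCube d m k ∩ ⋃ k ∈ K, dyadicCube d m k = ∅ := by
        simp only [← Set.disjoint_iff_inter_eq_empty, Set.disjoint_iUnion_right]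
        exact fun k' hk' => pairwiseDisjoint_dyadicCube d m Set.univ trivial trivial
          (fun h => hk (h ▸ hk'))
      rw [this]
      simp

/-- The cubes of positive mass in `[0,1)^d` carry the total mass. -/
theorem IsDyadicMeasure.exists_finset {d m : ℕ} {μ : Measure (EuclideanSpace ℝ (Fin d))}
    (hμ : IsDyadicMeasure d m μ) :
    ∃ K : Finset (Fin d → ℤ), (∀ k ∈ K, μ (dyadicCube d m k) ≠ 0) ∧
      1 ≤ ∑ k ∈ K, μ.real (dyadicCube d m k) := by
  classical
  have := hμ.1
  set L : Finset (Fin d → ℤ) := Fintype.piFinset fun _ => Finset.Ico 0 (2 ^ m) with hL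
  refine ⟨L.filter fun k => μ (dyadicCube d m k) ≠ 0, fun k hk => (Finset.mem_filter.mp hk).2, ?_⟩
  have hcover : {x : EuclideanSpace ℝ (Fin d) | ∀ i, 0 ≤ x i ∧ x i < 1} ⊆
      ⋃ k ∈ L, dyadicCube d m k := by
    intro x hx
    simp only [Set.mem_iUnion, exists_prop]
    refine ⟨fun i => ⌊x i * 2 ^ m⌋, ?_, mem_dyadicCube_iff.mpr fun _ => rfl⟩
    rw [hL, Fintype.mem_piFinset]
    intro i
    have h2 : (0 : ℝ) < 2 ^ m := by positivity
    rw [Finset.mem_Ico, Int.floor_nonneg, Int.floor_lt]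
    push_cast
    exact ⟨mul_nonneg (hx i).1 h2.le, by nlinarith [(hx i).2]⟩
  have h1 : μ (⋃ k ∈ L, dyadicCube d m k) = 1 := by
    refine (prob_compl_eq_zero_iff
      (Finset.measurableSet_biUnion _ fun k _ => measurableSet_dyadicCube d m k)).mp ?_
    exact measure_mono_null (Set.compl_subset_compl.mpr hcover) hμ.2.1
  rw [measure_biUnion_dyadicCube, ENNReal.ofReal_eq_one] at h1
  rw [← h1, Finset.sum_filter_of_ne]
  intro k _ hk h
  exact hk (by simp [Measure.real, h])

/-- **Lemma (Bourgain-type regularization).** If `μ` is a `2^{-Tℓ}`-measure on `[0,1)^d`,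
then there is a `2^{-Tℓ}`-set `X ⊆ supp_d(μ)` with `μ(X) ≥ (2Td+2)^{-ℓ}` such that the
normalized restriction `μ_X` is `σ`-regular for some `σ ∈ [-1, d-1]^ℓ`. -/
theorem statement6 (T d ℓ : ℕ) (hT : 1 ≤ T) (hd : 1 ≤ d) (hℓ : 1 ≤ ℓ)
    (μ : Measure (EuclideanSpace ℝ (Fin d))) (hμ : IsDyadicMeasure d (T * ℓ) μ) :
    ∃ (X : Set (EuclideanSpace ℝ (Fin d))) (K : Finset (Fin d → ℤ)),
      X = ⋃ k ∈ K, dyadicCube d (T * ℓ) k ∧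
      X ⊆ dyadicSupport d T μ ∧
      (((2 * T * d + 2 : ℕ) : ℝ≥0∞) ^ ℓ)⁻¹ ≤ μ X ∧
      ∃ σ : ℕ → ℝ, (∀ j, 1 ≤ j → j ≤ ℓ → σ j ∈ Set.Icc (-1 : ℝ) ((d : ℝ) - 1)) ∧
        IsRegularMeasure d T ℓ σ ((μ X)⁻¹ • μ.restrict X) := by
  classical
  have hprob := hμ.1
  obtain ⟨K₀, hK₀pos, hK₀⟩ := hμ.exists_finset
  obtain ⟨K, hKK₀, e, he, hsum, hreg⟩ := exists_regular_subtree (D := T * d)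
    (Nat.mul_pos hT hd) ℓ (fun j k i => k i / 2 ^ (T * ℓ - T * j))
    (fun q i => (q i).fdiv (2 ^ T))
    (fun j hj k => by
      funext i
      have hle : T * (j + 1) ≤ T * ℓ := Nat.mul_le_mul_left T hj
      have hexp : T * ℓ - T * j = (T * ℓ - T * (j + 1)) + T := by
        rw [mul_add, mul_one] at hle ⊢
        omega
      rw [Int.fdiv_eq_ediv_of_nonneg _ (by positivity), Int.ediv_ediv_of_nonneg (by positivity),
        hexp, pow_add])
    card_le_of_fdiv_eq (m := fun k => μ.real (dyadicCube d (T * ℓ) k))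
    (fun _ => measureReal_nonneg) K₀
  set m : (Fin d → ℤ) → ℝ := fun k => μ.real (dyadicCube d (T * ℓ) k) with hm
  have hμX : μ (⋃ k ∈ K, dyadicCube d (T * ℓ) k) = ENNReal.ofReal (∑ k ∈ K, m k) :=
    measure_biUnion_dyadicCube μ K
  have hN : (0 : ℝ) < (2 * (T * d : ℕ) + 2) ^ ℓ := by positivity
  have hlower : ((2 * (T * d : ℕ) + 2 : ℝ) ^ ℓ)⁻¹ ≤ ∑ k ∈ K, m k := by
    rw [inv_le_iff_one_le_mul₀' hN]
    exact hK₀.trans hsum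
  have hX0 : μ (⋃ k ∈ K, dyadicCube d (T * ℓ) k) ≠ 0 := by
    rw [hμX, ENNReal.ofReal_ne_zero_iff]
    exact (inv_pos.mpr hN).trans_le hlower
  refine ⟨_, K, rfl, ?_, ?_, fun j => (e (j - 1) : ℝ) / T - 1, ?_, ?_⟩
  · exact Set.iUnion₂_subset fun k hk => dyadicCube_subset_dyadicSupport hμ (hK₀pos k (hKK₀ hk))
  · rw [hμX]
    refine le_trans (le_of_eq ?_) (ENNReal.ofReal_le_ofReal hlower)
    rw [ENNReal.ofReal_inv_of_pos hN, ENNReal.ofReal_pow (by positivity)]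
    congr 2
    rw [← ENNReal.ofReal_natCast]
    congr 1
    push_cast
    ring
  · intro j _ _
    have hT0 : (0 : ℝ) < T := by exact_mod_cast hT
    have he' : (e (j - 1) : ℝ) ≤ d * T := by
      rw [mul_comm]
      exact_mod_cast he (j - 1)
    have h1 : (e (j - 1) : ℝ) / T ≤ d := (div_le_iff₀ hT0).mpr he'
    have h2 : (0 : ℝ) ≤ (e (j - 1) : ℝ) / T := by positivity
    constructor <;> linarith
  · refine ⟨hμ.inv_smul_restrict K hX0, fun j hj1 hjℓ q hq => ?_⟩
    obtain ⟨i, rfl⟩ : ∃ i, j = i + 1 := ⟨j - 1, by omega⟩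
    have hν : ∀ j ≤ ℓ, ∀ q, ((μ (⋃ k ∈ K, dyadicCube d (T * ℓ) k))⁻¹ •
        μ.restrict (⋃ k ∈ K, dyadicCube d (T * ℓ) k)) (dyadicCube d (T * j) q) =
        (μ (⋃ k ∈ K, dyadicCube d (T * ℓ) k))⁻¹ * ENNReal.ofReal
          (∑ k ∈ K.filter (fun k => (fun i => k i / 2 ^ (T * ℓ - T * j)) = q), m k) := by
      intro j hj q
      rw [Measure.smul_apply, Measure.restrict_apply (measurableSet_dyadicCube _ _ _),
        biUnion_dyadicCube_inter (Nat.mul_le_mul_left T hj), smul_eq_mul]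
      exact congrArg _ (measure_biUnion_dyadicCube μ _)
    rw [hν _ hjℓ] at hq ⊢
    beta_reduce
    rw [Nat.add_sub_cancel, hν i (by omega)]
    obtain ⟨h1, h2⟩ := hreg i hjℓ q (ENNReal.ofReal_pos.mp (pos_of_mul_pos_right hq zero_le))
    have hc : (2 : ℝ) ^ (-(T : ℝ) * ((e i : ℝ) / T - 1 + 1)) = (2 ^ e i)⁻¹ := by
      have hT0 : (T : ℝ) ≠ 0 := by positivity
      rw [sub_add_cancel, neg_mul, mul_div_cancel₀ _ hT0, Real.rpow_neg zero_le_two,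
        Real.rpow_natCast]
    have hpos : (0 : ℝ) < 2 ^ e i := by positivity
    rw [hc, mul_left_comm, ← ENNReal.ofReal_mul (by positivity), mul_left_comm 2]
    constructor
    · refine mul_le_mul_right (ENNReal.ofReal_le_ofReal ?_) _
      rwa [le_inv_mul_iff₀ hpos]
    · refine mul_le_mul_right ?_ _
      rw [← ENNReal.ofReal_ofNat 2, ← ENNReal.ofReal_mul zero_le_two]
      refine ENNReal.ofReal_le_ofReal ?_
      rw [inv_mul_le_iff₀ hpos]
      linarith
end

section
/- Let μ, ν be Borel probability measures on [0,1)² with disjoint supports satisfying E_s(μ) < ∞ and E_u(ν) < ∞ for some s ∈ (0,2) and u > max(1, 2−s). Then there exists κ > 0 (depending on μ and ν) such that: whenever Θ ⊂ [0,1)² × S¹ is a Borel set with (μ × H¹)(Θ) ≤ κ, where H¹ is one-dimensional Hausdorff measure on S¹, one has (μ × ν)({(x,y) : P_y(x) ∉ Θ_x}) > 2/3, where Θ_x = {θ ∈ S¹ : (x,θ) ∈ Θ}. -/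
open MeasureTheory
open scoped ENNReal NNReal

/-- The `s`-energy `E_s(μ) = ∬ |x - y|⁻ˢ dμ(x) dμ(y)` of a measure on `ℝ²`. -/
noncomputable def energy (s : ℝ) (μ : Measure (EuclideanSpace ℝ (Fin 2))) : ℝ≥0∞ :=
  ∫⁻ x, ∫⁻ y, edist x y ^ (-s) ∂μ ∂μ

/-- The (topological) support of a measure: points all of whose balls have positive mass. -/
def msupport (μ : Measure (EuclideanSpace ℝ (Fin 2))) : Set (EuclideanSpace ℝ (Fin 2)) :=
  {x | ∀ ε : ℝ, 0 < ε → 0 < μ (Metric.ball x ε)}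

/-- The tent function of width `r` and height `1 / r`. -/
noncomputable def tent (r t : ℝ) : ℝ := max 0 (1 - |t| / r) / r

theorem tent_nonneg {r : ℝ} (hr : 0 < r) (t : ℝ) : 0 ≤ tent r t := by
  unfold tent; positivity

theorem tent_le {r : ℝ} (hr : 0 < r) (t : ℝ) : tent r t ≤ 1 / r := by
  unfold tent
  gcongr
  apply max_le (by norm_num)
  have : 0 ≤ |t| / r := by positivity
  linarith

theorem tent_neg (r t : ℝ) : tent r (-t) = tent r t := by simp [tent]

theorem tent_eq_zero {r t : ℝ} (hr : 0 < r) (ht : r ≤ |t|) : tent r t = 0 := by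
  have : 1 ≤ |t| / r := (one_le_div hr).2 ht
  unfold tent
  rw [max_eq_left (by linarith)]; simp

theorem le_tent {r t c : ℝ} (hr : 0 < r) (ht : |t| ≤ c * r) : (1 - c) / r ≤ tent r t := by
  unfold tent
  gcongr
  apply le_max_of_le_right
  have : |t| / r ≤ c := (div_le_iff₀ hr).2 ht
  linarith

theorem continuous_tent (r : ℝ) : Continuous (tent r) := by
  unfold tent; fun_prop

theorem abs_tent_sub_le {r : ℝ} (hr : 0 < r) (a b : ℝ) :
    |tent r a - tent r b| ≤ |a - b| / r ^ 2 := by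
  unfold tent
  rw [← sub_div, abs_div, abs_of_pos hr, div_le_div_iff₀ hr (by positivity)]
  have h1 : |max 0 (1 - |a| / r) - max 0 (1 - |b| / r)| ≤ |a - b| / r := by
    have h2 := abs_max_sub_max_le_max 0 (1 - |a| / r) 0 (1 - |b| / r)
    rw [sub_self, abs_zero, max_eq_right (abs_nonneg (1 - |a| / r - (1 - |b| / r)))] at h2
    refine h2.trans ?_
    rw [show 1 - |a| / r - (1 - |b| / r) = (|b| - |a|) / r by ring, abs_div, abs_of_pos hr]
    exact div_le_div_of_nonneg_right ((abs_abs_sub_abs_le b a).trans_eq (abs_sub_comm b a)) hr.le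
  rw [le_div_iff₀ hr] at h1
  nlinarith

theorem integrable_tent {r : ℝ} (hr : 0 < r) : Integrable (tent r) := by
  apply (continuous_tent r).integrable_of_hasCompactSupport
  apply HasCompactSupport.of_support_subset_isCompact (isCompact_Icc (a := -r) (b := r))
  intro t ht
  rw [Function.mem_support] at ht
  have : |t| < r := by
    by_contra! h
    exact ht (tent_eq_zero hr h)
  exact ⟨(abs_lt.1 this).1.le, (abs_lt.1 this).2.le⟩

theorem integral_tent {r : ℝ} (hr : 0 < r) : ∫ t, tent r t = ∫ t, tent 1 t := by
  have h : ∀ t, tent r t = r⁻¹ * tent 1 (t / r) := by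
    intro t
    simp [tent, abs_div, abs_of_pos hr]
    ring
  simp_rw [h]
  rw [integral_const_mul, Measure.integral_comp_div, abs_of_pos hr, smul_eq_mul, ← mul_assoc,
    inv_mul_cancel₀ hr.ne', one_mul]

/-- The difference of two consecutive dyadic tent functions, a wavelet of mean zero. -/
noncomputable def tentDiff (r t : ℝ) : ℝ := tent (r / 2) t - tent r t

/-- The sum of two consecutive dyadic tent functions. -/
noncomputable def tentSum (r t : ℝ) : ℝ := tent (r / 2) t + tent r t

theorem continuous_tentDiff (r : ℝ) : Continuous (tentDiff r) :=
  (continuous_tent _).sub (continuous_tent _)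

theorem continuous_tentSum (r : ℝ) : Continuous (tentSum r) :=
  (continuous_tent _).add (continuous_tent _)

theorem integrable_tentDiff {r : ℝ} (hr : 0 < r) : Integrable (tentDiff r) :=
  (integrable_tent (half_pos hr)).sub (integrable_tent hr)

theorem integrable_tentSum {r : ℝ} (hr : 0 < r) : Integrable (tentSum r) :=
  (integrable_tent (half_pos hr)).add (integrable_tent hr)

theorem integral_tentDiff {r : ℝ} (hr : 0 < r) : ∫ t, tentDiff r t = 0 := by
  unfold tentDiff
  rw [integral_sub (integrable_tent (half_pos hr)) (integrable_tent hr),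
    integral_tent (half_pos hr), integral_tent hr, sub_self]

theorem abs_tentDiff_le {r : ℝ} (hr : 0 < r) (t : ℝ) : |tentDiff r t| ≤ 2 / r := by
  have h1 := tent_nonneg hr t
  have h2 := tent_le hr t
  have h3 := tent_nonneg (half_pos hr) t
  have h4 := tent_le (half_pos hr) t
  have h5 : 1 / (r / 2) = 2 / r := by field_simp
  have h6 : 1 / r ≤ 2 / r := by gcongr; norm_num
  unfold tentDiff
  rw [abs_le]; constructor <;> linarith

theorem tentDiff_eq_zero {r t : ℝ} (hr : 0 < r) (ht : r ≤ |t|) : tentDiff r t = 0 := by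
  unfold tentDiff
  rw [tent_eq_zero hr ht, tent_eq_zero (half_pos hr) (by linarith), sub_zero]

theorem tentSum_eq_zero {r t : ℝ} (hr : 0 < r) (ht : r ≤ |t|) : tentSum r t = 0 := by
  unfold tentSum
  rw [tent_eq_zero hr ht, tent_eq_zero (half_pos hr) (by linarith), add_zero]

theorem abs_tentSum_le {r : ℝ} (hr : 0 < r) (t : ℝ) : |tentSum r t| ≤ 3 / r := by
  have h1 := tent_nonneg hr t
  have h2 := tent_le hr t
  have h3 := tent_nonneg (half_pos hr) t
  have h4 := tent_le (half_pos hr) t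
  have h5 : 1 / (r / 2) = 2 / r := by field_simp
  have h6 : 1 / r + 2 / r = 3 / r := by ring
  have h7 : 0 < 3 / r := by positivity
  unfold tentSum
  rw [abs_le]; constructor <;> linarith

theorem abs_tentDiff_sub_le {r : ℝ} (hr : 0 < r) (a b : ℝ) :
    |tentDiff r a - tentDiff r b| ≤ 5 / r ^ 2 * |a - b| := by
  have h1 := abs_tent_sub_le hr a b
  have h2 := abs_tent_sub_le (half_pos hr) a b
  have h3 : |a - b| / (r / 2) ^ 2 + |a - b| / r ^ 2 = 5 / r ^ 2 * |a - b| := by field_simp; ring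
  unfold tentDiff
  rw [← h3, show tent (r / 2) a - tent r a - (tent (r / 2) b - tent r b)
    = (tent (r / 2) a - tent (r / 2) b) - (tent r a - tent r b) by ring]
  exact (abs_sub _ _).trans (add_le_add h2 h1)

/-- A function bounded by `M` and vanishing off `(-r, r)` has integral at most `2 r M`. -/
theorem integral_abs_le_of_support {f : ℝ → ℝ} {r M : ℝ} (hr : 0 < r)
    (hM : ∀ t, |f t| ≤ M) (hf : ∀ t, r ≤ |t| → f t = 0) : ∫ t, |f t| ≤ 2 * r * M := by
  have h : ∫ t, |f t| = ∫ t in Set.Icc (-r) r, |f t| := by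
    symm
    apply setIntegral_eq_integral_of_forall_compl_eq_zero
    intro t ht
    rw [hf t, abs_zero]
    by_contra! h
    exact ht ⟨(abs_lt.1 h).1.le, (abs_lt.1 h).2.le⟩
  rw [h]
  have := norm_setIntegral_le_of_norm_le_const (μ := volume) (s := Set.Icc (-r) r)
    (f := fun t => |f t|) (C := M) (by simp) (fun t _ => by simpa using hM t)
  refine (le_abs_self _).trans (this.trans (le_of_eq ?_))
  simp [hr.le]
  ring

/-- The correlation `∫ φ (a - t) ψ (b - t) dt`. -/
noncomputable def corr (φ ψ : ℝ → ℝ) (a b : ℝ) : ℝ := ∫ t, φ (a - t) * ψ (b - t)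

theorem corr_eq (φ ψ : ℝ → ℝ) (a b : ℝ) : corr φ ψ a b = ∫ t, φ t * ψ (t + (b - a)) := by
  unfold corr
  rw [← integral_sub_left_eq_self (fun t => φ t * ψ (t + (b - a))) volume a]
  congr 1; ext t; congr 2; ring

theorem corr_comm_of_even {φ ψ : ℝ → ℝ} (hφ : ∀ t, φ (-t) = φ t) (hψ : ∀ t, ψ (-t) = ψ t)
    (a b : ℝ) : corr φ ψ a b = corr ψ φ a b := by
  unfold corr
  rw [← integral_sub_left_eq_self _ volume (a + b)]
  congr 1; ext t
  rw [← hφ, ← hψ, mul_comm]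
  congr 2 <;> ring

theorem integrable_corr {φ ψ : ℝ → ℝ} {M : ℝ} (hφ : Integrable φ)
    (hψ : Continuous ψ) (hM : ∀ t, |ψ t| ≤ M) (a b : ℝ) :
    Integrable fun t => φ (a - t) * ψ (b - t) :=
  (hφ.comp_sub_left a).mul_bdd (c := M) (by fun_prop) (ae_of_all _ fun t => hM _)

theorem abs_corr_le {φ ψ : ℝ → ℝ} {r M : ℝ} (hr : 0 < r)
    (hφM : ∀ t, |φ t| ≤ M) (hφ : ∀ t, r ≤ |t| → φ t = 0) (hM : ∀ t, |ψ t| ≤ M) (a b : ℝ) :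
    |corr φ ψ a b| ≤ 2 * r * M ^ 2 := by
  rw [corr_eq]
  refine (abs_integral_le_integral_abs).trans ?_
  have hM0 : 0 ≤ M := (abs_nonneg _).trans (hM 0)
  refine (integral_abs_le_of_support hr (M := M ^ 2) (fun t => ?_) (fun t ht => ?_))
  · rw [abs_mul, sq]
    exact mul_le_mul (hφM _) (hM _) (abs_nonneg _) hM0
  · rw [hφ t ht, zero_mul]

theorem corr_eq_zero {φ ψ : ℝ → ℝ} {r : ℝ} (hφ : ∀ t, r ≤ |t| → φ t = 0)
    (hψ : ∀ t, r ≤ |t| → ψ t = 0) {a b : ℝ} (hab : 2 * r ≤ |a - b|) : corr φ ψ a b = 0 := by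
  unfold corr
  apply integral_eq_zero_of_ae
  refine ae_of_all _ fun t => ?_
  by_cases h : r ≤ |a - t|
  · simp [hφ _ h]
  · have : r ≤ |b - t| := by
      by_contra! h'
      have := abs_sub_le a t b
      rw [abs_sub_comm t b] at this
      linarith
    simp [hψ _ this]

theorem corr_tent_nonneg {r : ℝ} (hr : 0 < r) (a b : ℝ) : 0 ≤ corr (tent r) (tent r) a b :=
  integral_nonneg fun _ => mul_nonneg (tent_nonneg hr _) (tent_nonneg hr _)

theorem corr_tent_ge {r a b : ℝ} (hr : 0 < r) (hab : |a - b| ≤ r / 4) :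
    3 / 16 / r ≤ corr (tent r) (tent r) a b := by
  have hi : Integrable fun t => tent r (a - t) * tent r (b - t) :=
    integrable_corr (integrable_tent hr) (continuous_tent r) (M := 1 / r)
      (fun t => by rw [abs_of_nonneg (tent_nonneg hr t)]; exact tent_le hr t) a b
  have h0 : ∀ t, 0 ≤ tent r (a - t) * tent r (b - t) :=
    fun _ => mul_nonneg (tent_nonneg hr _) (tent_nonneg hr _)
  have h1 : ∫ t in Set.Icc (a - r / 4) (a + r / 4), (3 / 8 / r ^ 2 : ℝ)
      ≤ ∫ t in Set.Icc (a - r / 4) (a + r / 4), tent r (a - t) * tent r (b - t) := by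
    apply setIntegral_mono_on (by simp) hi.integrableOn measurableSet_Icc
    intro t ht
    have ha : |a - t| ≤ 1 / 4 * r := by
      rw [abs_le]; constructor <;> linarith [ht.1, ht.2]
    have hb : |b - t| ≤ 1 / 2 * r := by
      have := abs_sub_le b a t
      rw [abs_sub_comm b a] at this
      linarith
    have h3 := le_tent hr ha
    have h4 := le_tent hr hb
    calc (3 / 8 / r ^ 2 : ℝ) = (1 - 1 / 4) / r * ((1 - 1 / 2) / r) := by field_simp; norm_num
      _ ≤ _ := mul_le_mul h3 h4 (by norm_num; positivity) (tent_nonneg hr _)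
  have h2 : ∫ t in Set.Icc (a - r / 4) (a + r / 4), (3 / 8 / r ^ 2 : ℝ) = 3 / 16 / r := by
    rw [setIntegral_const, measureReal_def, Real.volume_Icc,
      ENNReal.toReal_ofReal (by linarith), smul_eq_mul]
    field_simp
    ring
  rw [← h2]
  exact h1.trans (setIntegral_le_integral hi (ae_of_all _ h0))

theorem corr_translate (φ ψ : ℝ → ℝ) (a b : ℝ) : corr φ ψ a b = corr φ ψ 0 (b - a) := by
  rw [corr_eq, corr_eq, sub_zero]

theorem abs_integral_tentDiff_sin_le_of_two_mul_le {r R τ : ℝ} (hr : 0 < r) (hR : 2 * r ≤ R)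
    (hτ : |τ| ≤ r) :
    |∫ θ in -(Real.pi / 2)..(Real.pi / 2), tentDiff r (τ + R * Real.sin θ)| ≤ 300 * (r / R ^ 2) := by
  have hR0 : 0 < R := by linarith
  have hpi := Real.pi_pos
  have hpi4 := Real.pi_le_four
  set δ := Real.pi * r / R with hδ
  have hδ0 : 0 < δ := by positivity
  have hδpi : δ ≤ Real.pi / 2 := by
    rw [hδ, div_le_iff₀ hR0]; nlinarith
  have hvan : ∀ v : ℝ, 2 * r ≤ |v| → tentDiff r (τ + v) = 0 := by
    intro v hv
    apply tentDiff_eq_zero hr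
    have := abs_sub_abs_le_abs_sub v (-τ)
    rw [abs_neg, sub_neg_eq_add, add_comm v] at this
    linarith
  have hlin : ∫ θ in -(Real.pi / 2)..(Real.pi / 2), tentDiff r (τ + R * θ) = 0 := by
    rw [intervalIntegral.integral_comp_add_mul _ hR0.ne', intervalIntegral.integral_of_le
      (by nlinarith), setIntegral_eq_integral_of_forall_compl_eq_zero, integral_tentDiff hr,
      smul_zero]
    intro t ht
    apply tentDiff_eq_zero hr
    by_contra! h
    have h1 := abs_lt.1 h
    have h2 := abs_le.1 hτ
    have h3 : R * 1 ≤ R * (Real.pi / 2) := by gcongr; linarith [Real.pi_gt_three]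
    exact ht ⟨by linarith, by linarith⟩
  have hcd := continuous_tentDiff r
  set d : ℝ → ℝ := fun θ => tentDiff r (τ + R * Real.sin θ) - tentDiff r (τ + R * θ) with hd
  have hdiff : ∫ θ in -(Real.pi / 2)..(Real.pi / 2), tentDiff r (τ + R * Real.sin θ)
      = ∫ θ in -(Real.pi / 2)..(Real.pi / 2), d θ := by
    rw [hd, intervalIntegral.integral_sub, hlin, sub_zero]
    · exact Continuous.intervalIntegrable (by fun_prop) _ _
    · exact Continuous.intervalIntegrable (by fun_prop) _ _
  have hsmall : ∫ θ in -(Real.pi / 2)..(Real.pi / 2), d θ = ∫ θ in -δ..δ, d θ := by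
    rw [intervalIntegral.integral_of_le (by linarith), intervalIntegral.integral_of_le (by linarith)]
    apply setIntegral_eq_of_subset_of_forall_sdiff_eq_zero measurableSet_Ioc
    · exact Set.Ioc_subset_Ioc (by linarith) hδpi
    · rintro θ ⟨h1, h2⟩
      have h3 : δ ≤ |θ| := by
        by_contra! h
        exact h2 ⟨(abs_lt.1 h).1, (abs_lt.1 h).2.le⟩
      have h4 := Real.mul_abs_le_abs_sin (x := θ) (abs_le.2 ⟨h1.1.le, h1.2⟩)
      have h5 : 2 * r ≤ |R * Real.sin θ| := by
        rw [abs_mul, abs_of_pos hR0]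
        calc 2 * r = R * (2 / Real.pi * δ) := by rw [hδ]; field_simp
          _ ≤ R * (2 / Real.pi * |θ|) := by gcongr
          _ ≤ _ := by gcongr
      have h6 : 2 * r ≤ |R * θ| := by
        refine h5.trans ?_
        rw [abs_mul, abs_mul]
        exact mul_le_mul_of_nonneg_left Real.abs_sin_le_abs (abs_nonneg _)
      simp only [hd]
      rw [hvan _ h5, hvan _ h6, sub_zero]
  rw [hdiff, hsmall]
  have hb : ∀ θ ∈ Set.uIoc (-δ) δ, ‖d θ‖ ≤ 5 / r ^ 2 * (R * (δ ^ 3 / 6)) := by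
    intro θ hθ
    rw [Set.uIoc_of_le (by linarith)] at hθ
    have h1 : |θ| ≤ δ := abs_le.2 ⟨hθ.1.le, hθ.2⟩
    refine (abs_tentDiff_sub_le hr _ _).trans ?_
    rw [show τ + R * Real.sin θ - (τ + R * θ) = R * (Real.sin θ - θ) by ring, abs_mul,
      abs_of_pos hR0, abs_sub_comm]
    gcongr
    refine (Real.abs_sub_sin_le θ).trans ?_
    gcongr
  refine (intervalIntegral.norm_integral_le_of_norm_le_const hb).trans ?_
  rw [abs_of_pos (by linarith), hδ]
  have h1 : 5 / r ^ 2 * (R * ((Real.pi * r / R) ^ 3 / 6)) * (Real.pi * r / R - -(Real.pi * r / R))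
      = Real.pi ^ 4 * (5 / 3) * (r / R ^ 2) * (r / R) := by field_simp; ring
  rw [h1]
  have h2 : r / R ≤ 1 / 2 := by rw [div_le_iff₀ hR0]; linarith
  have h3 : Real.pi ^ 4 ≤ 4 ^ 4 := by gcongr
  calc Real.pi ^ 4 * (5 / 3) * (r / R ^ 2) * (r / R)
      ≤ 4 ^ 4 * (5 / 3) * (r / R ^ 2) * (1 / 2) := by gcongr
    _ ≤ 300 * (r / R ^ 2) := by
      have : 0 ≤ r / R ^ 2 := by positivity
      linarith

/-- Averages of a mean zero wavelet along the circle decay. -/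
theorem abs_integral_tentDiff_sin_le {r R τ u : ℝ} (hr : 0 < r) (hR : 0 < R) (hτ : |τ| ≤ r)
    (hu0 : 0 ≤ u) (hu : u ≤ 2) (θ₀ : ℝ) :
    |∫ θ in Set.Ioc (-Real.pi) Real.pi, tentDiff r (τ + R * Real.sin (θ - θ₀))|
      ≤ 600 * (r ^ (u - 1) * R ^ (-u)) := by
  have hpi := Real.pi_pos
  have hcd := continuous_tentDiff r
  rcases le_or_gt (2 * r) R with h | h
  · set f : ℝ → ℝ := fun θ => tentDiff r (τ + R * Real.sin θ) with hf
    have hper : Function.Periodic f (2 * Real.pi) := by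
      intro θ; simp [hf]
    have hii : ∀ a b, IntervalIntegrable f volume a b := fun a b =>
      Continuous.intervalIntegrable (by fun_prop) a b
    have h1 : ∫ θ in Set.Ioc (-Real.pi) Real.pi, tentDiff r (τ + R * Real.sin (θ - θ₀))
        = 2 * ∫ θ in -(Real.pi / 2)..(Real.pi / 2), f θ := by
      rw [← intervalIntegral.integral_of_le (by linarith)]
      have e1 : ∫ θ in -Real.pi..Real.pi, tentDiff r (τ + R * Real.sin (θ - θ₀))
        = ∫ θ in (-Real.pi - θ₀)..(Real.pi - θ₀), f θ :=
        intervalIntegral.integral_comp_sub_right f θ₀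
      have e2 := hper.intervalIntegral_add_eq (-Real.pi - θ₀) (-(Real.pi / 2))
      rw [show -Real.pi - θ₀ + 2 * Real.pi = Real.pi - θ₀ by ring] at e2
      have e3 : ∫ θ in (Real.pi / 2)..(-(Real.pi / 2) + 2 * Real.pi), f θ
          = ∫ θ in -(Real.pi / 2)..(Real.pi / 2), f θ := by
        have := intervalIntegral.integral_comp_sub_left (a := -(Real.pi / 2)) (b := Real.pi / 2)
          f Real.pi
        rw [show Real.pi - Real.pi / 2 = Real.pi / 2 by ring,
          show Real.pi - -(Real.pi / 2) = -(Real.pi / 2) + 2 * Real.pi by ring] at this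
        rw [← this]
        simp [hf, Real.sin_pi_sub]
      rw [e1, e2, ← intervalIntegral.integral_add_adjacent_intervals
        (hii (-(Real.pi / 2)) (Real.pi / 2)) (hii _ _), e3]
      ring
    rw [h1, abs_mul, abs_two]
    have h2 := abs_integral_tentDiff_sin_le_of_two_mul_le hr h hτ
    have h3 : r / R ^ 2 ≤ r ^ (u - 1) * R ^ (-u) := by
      calc r / R ^ 2 = r ^ (u - 1) * r ^ (2 - u) * R ^ (-2 : ℝ) := by
            rw [← Real.rpow_add hr, Real.rpow_neg hR.le, div_eq_mul_inv]
            norm_num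
        _ ≤ r ^ (u - 1) * R ^ (2 - u) * R ^ (-2 : ℝ) := by
            gcongr
            · linarith
        _ = r ^ (u - 1) * R ^ (-u) := by
            rw [mul_assoc, ← Real.rpow_add hR]
            ring_nf
    linarith
  · have h1 := norm_setIntegral_le_of_norm_le_const (μ := volume)
      (s := Set.Ioc (-Real.pi) Real.pi)
      (f := fun θ => tentDiff r (τ + R * Real.sin (θ - θ₀))) (C := 2 / r) (by simp)
      (fun t _ => abs_tentDiff_le hr _)
    rw [measureReal_def, Real.volume_Ioc, ENNReal.toReal_ofReal (by linarith)] at h1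
    refine h1.trans ?_
    have h2 : r ^ (-u) * (1 / 4) ≤ R ^ (-u) := by
      calc r ^ (-u) * (1 / 4) ≤ r ^ (-u) * 2 ^ (-u) := by
            gcongr
            calc (1 / 4 : ℝ) = 2 ^ (-2 : ℝ) := by rw [Real.rpow_neg (by norm_num)]; norm_num
              _ ≤ 2 ^ (-u) := Real.rpow_le_rpow_of_exponent_le (by norm_num) (by linarith)
        _ = (r * 2) ^ (-u) := (Real.mul_rpow hr.le (by norm_num)).symm
        _ ≤ R ^ (-u) := Real.rpow_le_rpow_of_nonpos hR (by linarith) (by linarith)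
    have h3 : 1 / r * (1 / 4) ≤ r ^ (u - 1) * R ^ (-u) := by
      calc 1 / r * (1 / 4) = r ^ (u - 1) * (r ^ (-u) * (1 / 4)) := by
            rw [← mul_assoc, ← Real.rpow_add hr]
            rw [show u - 1 + -u = -1 by ring, Real.rpow_neg_one, one_div]
        _ ≤ _ := by gcongr
    have h4 : 2 / r * (Real.pi - -Real.pi) = 16 * Real.pi * (1 / r * (1 / 4)) := by ring
    rw [h4]
    have h5 : 0 ≤ 1 / r * (1 / 4) := by positivity
    nlinarith [Real.pi_le_four]

theorem integrable_mul_shift {φ ψ : ℝ → ℝ} {M : ℝ} (hφ : Integrable φ)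
    (hψ : Continuous ψ) (hM : ∀ t, |ψ t| ≤ M) {g : ℝ → ℝ} (hg : Continuous g) :
    Integrable (fun p : ℝ × ℝ => φ p.2 * ψ (p.2 + g p.1))
      ((volume.restrict (Set.Ioc (-Real.pi) Real.pi)).prod volume) :=
  (hφ.comp_snd _).mul_bdd (c := M) (by fun_prop) (ae_of_all _ fun t => hM _)

theorem abs_integral_corr_tentDiff_le {r R u : ℝ} (hr : 0 < r) (hR : 0 < R)
    (hu0 : 0 ≤ u) (hu : u ≤ 2) (θ₀ : ℝ) :
    |∫ θ in Set.Ioc (-Real.pi) Real.pi,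
        corr (tentDiff r) (tentDiff r) 0 (R * Real.sin (θ - θ₀))|
      ≤ 2400 * (r ^ (u - 1) * R ^ (-u)) := by
  have hint := integrable_mul_shift (integrable_tentDiff hr) (continuous_tentDiff r)
    (abs_tentDiff_le hr) (g := fun θ => R * Real.sin (θ - θ₀)) (by fun_prop)
  simp_rw [corr_eq, sub_zero]
  rw [integral_integral_swap hint]
  simp_rw [integral_const_mul]
  set C := 600 * (r ^ (u - 1) * R ^ (-u)) with hC
  have h1 : ∀ τ, |tentDiff r τ * ∫ θ in Set.Ioc (-Real.pi) Real.pi,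
      tentDiff r (τ + R * Real.sin (θ - θ₀))| ≤ 2 / r * C := by
    intro τ
    rcases le_or_gt r |τ| with h | h
    · rw [tentDiff_eq_zero hr h, zero_mul, abs_zero]; positivity
    · rw [abs_mul]
      exact mul_le_mul (abs_tentDiff_le hr _)
        (abs_integral_tentDiff_sin_le hr hR h.le hu0 hu θ₀) (abs_nonneg _) (by positivity)
  refine abs_integral_le_integral_abs.trans
    ((integral_abs_le_of_support hr h1 fun τ hτ => ?_).trans (le_of_eq ?_))
  · rw [tentDiff_eq_zero hr hτ, zero_mul]
  · rw [hC]; field_simp; ring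

/-- The Euclidean plane. -/
abbrev Plane := EuclideanSpace ℝ (Fin 2)

/-- The signed distance of `z` to the line through the origin in direction `θ`. -/
noncomputable def lineProj (θ : ℝ) (z : Plane) : ℝ := z 0 * Real.sin θ - z 1 * Real.cos θ

/-- The unit vector of angle `θ`. -/
noncomputable def dir (θ : ℝ) : Plane := !₂[Real.cos θ, Real.sin θ]

/-- The arclength measure on the parameter interval `(-π, π]`. -/
noncomputable def arc : Measure ℝ := volume.restrict (Set.Ioc (-Real.pi) Real.pi)

instance isFiniteMeasure_arc : IsFiniteMeasure arc := by unfold arc; infer_instance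

theorem continuous_dir : Continuous dir := by unfold dir; fun_prop

theorem measurable_dir : Measurable dir := continuous_dir.measurable

theorem continuous_lineProj : Continuous fun p : ℝ × Plane => lineProj p.1 p.2 := by
  unfold lineProj; fun_prop

theorem lineProj_sub (θ : ℝ) (x y : Plane) :
    lineProj θ (x - y) = lineProj θ x - lineProj θ y := by
  simp [lineProj]; ring

theorem lineProj_smul_dir (R θ θ₀ : ℝ) : lineProj θ (R • dir θ₀) = R * Real.sin (θ - θ₀) := by
  simp [lineProj, dir, Real.sin_sub]; ring

theorem exists_polar (z : Plane) : ∃ θ₀ ∈ Set.Ioc (-Real.pi) Real.pi, z = ‖z‖ • dir θ₀ := by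
  set w : ℂ := ⟨z 0, z 1⟩
  have hn : ‖z‖ = ‖w‖ := by
    rw [EuclideanSpace.norm_eq, Complex.norm_eq_sqrt_sq_add_sq]; simp [w]
  refine ⟨w.arg, Complex.arg_mem_Ioc w, ?_⟩
  ext i
  fin_cases i
  · simp [dir, hn, Complex.norm_mul_cos_arg, w]
  · simp [dir, hn, Complex.norm_mul_sin_arg, w]

theorem le_norm_dir_sub {a b : ℝ} (h : |a - b| ≤ Real.pi) :
    2 / Real.pi * |a - b| ≤ ‖dir a - dir b‖ := by
  have h1 : ‖dir a - dir b‖ = 2 * |Real.sin ((a - b) / 2)| := by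
    rw [EuclideanSpace.norm_eq, ← abs_of_pos (two_pos (α := ℝ)), ← abs_mul, ← Real.sqrt_sq_eq_abs,
      abs_two]
    congr 1
    have h2 := Real.sin_sq_eq_half_sub ((a - b) / 2)
    rw [mul_div_cancel₀ _ two_ne_zero, Real.cos_sub] at h2
    rw [mul_pow, h2]
    simp [dir]
    nlinarith [Real.sin_sq_add_cos_sq a, Real.sin_sq_add_cos_sq b]
  rw [h1]
  have := Real.mul_abs_le_abs_sin (x := (a - b) / 2) (by rw [abs_div, abs_two]; gcongr)
  rw [abs_div, abs_two] at this
  linarith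

theorem volume_inter_dir_preimage_le {s : Set ℝ} (hs : ∀ a ∈ s, ∀ b ∈ s, |a - b| ≤ Real.pi)
    (A : Set Plane) :
    volume (s ∩ dir ⁻¹' A) ≤ ENNReal.ofReal (Real.pi / 2) * μH[1] A := by
  have hpi := Real.pi_pos
  have hbi : ∀ a ∈ s, ∀ b ∈ s, |a - b| ≤ Real.pi / 2 * ‖dir a - dir b‖ := by
    intro a ha b hb
    have := le_norm_dir_sub (hs a ha b hb)
    calc |a - b| = Real.pi / 2 * (2 / Real.pi * |a - b|) := by field_simp
      _ ≤ _ := by gcongr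
  have hinj : Set.InjOn dir s := by
    intro a ha b hb hab
    have := hbi a ha b hb
    rw [hab, sub_self, norm_zero, mul_zero] at this
    exact sub_eq_zero.1 (abs_nonpos_iff.1 this)
  set f := Function.invFunOn dir s with hf
  have hfl : ∀ a ∈ s, f (dir a) = a := fun a ha => hinj.leftInvOn_invFunOn ha
  set T := dir '' (s ∩ dir ⁻¹' A)
  have hT : f '' T = s ∩ dir ⁻¹' A := by
    rw [Set.image_image]
    exact (Set.image_congr fun a ha => hfl a ha.1).trans (Set.image_id _)
  have hL : LipschitzOnWith (Real.toNNReal (Real.pi / 2)) f T := by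
    apply LipschitzOnWith.of_dist_le_mul
    rintro _ ⟨a, ha, rfl⟩ _ ⟨b, hb, rfl⟩
    rw [hfl a ha.1, hfl b hb.1, Real.dist_eq, dist_eq_norm, Real.coe_toNNReal _ (by positivity)]
    exact hbi a ha.1 b hb.1
  have := hL.hausdorffMeasure_image_le (d := 1) zero_le_one
  rw [hT, ENNReal.rpow_one, hausdorffMeasure_real] at this
  refine this.trans ?_
  rw [ENNReal.ofReal]
  gcongr
  rintro _ ⟨a, ha, rfl⟩
  exact ha.2

/-- Pulled back by the angle, arclength is controlled by one-dimensional Hausdorff measure. -/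
theorem arc_preimage_dir_le {A : Set Plane} (hA : MeasurableSet A) :
    arc (dir ⁻¹' A) ≤ ENNReal.ofReal Real.pi * μH[1] A := by
  have hpi := Real.pi_pos
  rw [arc, Measure.restrict_apply (measurable_dir hA), Set.inter_comm,
    ← Set.Ioc_union_Ioc_eq_Ioc (b := 0) (by linarith) hpi.le, Set.union_inter_distrib_right]
  refine (measure_union_le _ _).trans ?_
  have h1 := volume_inter_dir_preimage_le (s := Set.Ioc (-Real.pi) 0) (A := A)
    (fun a ha b hb => abs_le.2 ⟨by linarith [ha.1, hb.2], by linarith [ha.2, hb.1]⟩)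
  have h2 := volume_inter_dir_preimage_le (s := Set.Ioc 0 Real.pi) (A := A)
    (fun a ha b hb => abs_le.2 ⟨by linarith [ha.1, hb.2], by linarith [ha.2, hb.1]⟩)
  refine (add_le_add h1 h2).trans (le_of_eq ?_)
  rw [← add_mul, ← ENNReal.ofReal_add (by positivity) (by positivity), add_halves]

theorem lintegral_enorm_rpow_lt_top {s : ℝ} (hs : s < 1) (A : ℝ) :
    ∫⁻ t in Set.Ioc (-A) A, ‖t‖ₑ ^ (-s) < ⊤ := by
  rcases le_or_gt A 0 with hA | hA
  · rw [Set.Ioc_eq_empty (by linarith)]; simp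
  have h := intervalIntegral.intervalIntegrable_cpow' (a := -A) (b := A) (r := ((-s : ℝ) : ℂ))
    (by rw [Complex.ofReal_re]; linarith)
  rw [intervalIntegrable_iff_integrableOn_Ioc_of_le (by linarith)] at h
  refine lt_of_eq_of_lt (lintegral_congr_ae ?_) h.2
  have h0 : ∀ᵐ t ∂(volume.restrict (Set.Ioc (-A) A)), t ≠ (0 : ℝ) := by
    apply ae_restrict_of_ae
    exact Measure.ae_ne volume 0
  filter_upwards [h0] with t ht
  rw [← ofReal_norm, ← ofReal_norm, Complex.norm_cpow_real,
    ENNReal.ofReal_rpow_of_pos (norm_pos_iff.2 ht), Complex.norm_real]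

theorem exists_int_abs_sub_le {t : ℝ} (ht : |t| ≤ 2 * Real.pi) :
    ∃ j ∈ Finset.Icc (-2 : ℤ) 2, |t - j * Real.pi| ≤ Real.pi / 2 := by
  have hpi := Real.pi_pos
  have h1 := abs_sub_round (t / Real.pi)
  have h3 : |t / Real.pi| ≤ 2 := by
    rw [abs_div, abs_of_pos hpi, div_le_iff₀ hpi]; exact ht
  refine ⟨round (t / Real.pi), ?_, ?_⟩
  · rw [abs_le] at h1 h3
    rw [Finset.mem_Icc]
    have h4 : (round (t / Real.pi) : ℝ) < 3 := by linarith
    have h5 : (-3 : ℝ) < (round (t / Real.pi) : ℝ) := by linarith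
    have h6 : round (t / Real.pi) < 3 := by exact_mod_cast h4
    have h7 : -3 < round (t / Real.pi) := by exact_mod_cast h5
    constructor <;> omega
  · have : t - round (t / Real.pi) * Real.pi = (t / Real.pi - round (t / Real.pi)) * Real.pi := by
      field_simp
    rw [this, abs_mul, abs_of_pos hpi]
    nlinarith

theorem ENNReal.rpow_neg_le_rpow_neg {a b : ℝ≥0∞} {s : ℝ} (hab : a ≤ b) (hs : 0 ≤ s) :
    b ^ (-s) ≤ a ^ (-s) := by
  rw [ENNReal.rpow_neg, ENNReal.rpow_neg]
  exact ENNReal.inv_le_inv.2 (ENNReal.rpow_le_rpow hab hs)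

theorem enorm_sin_rpow_le {s t : ℝ} (hs : 0 ≤ s) (ht : |t| ≤ 2 * Real.pi) :
    ‖Real.sin t‖ₑ ^ (-s) ≤ ‖(2 / Real.pi : ℝ)‖ₑ ^ (-s) *
      ∑ j ∈ Finset.Icc (-2 : ℤ) 2, ‖t - j * Real.pi‖ₑ ^ (-s) := by
  obtain ⟨j, hj, hjt⟩ := exists_int_abs_sub_le ht
  have h1 := Real.mul_abs_le_abs_sin hjt
  have h2 : |Real.sin (t - j * Real.pi)| = |Real.sin t| := by
    rw [Real.sin_sub_int_mul_pi, abs_mul, abs_zpow, abs_neg, abs_one, one_zpow, one_mul]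
  rw [h2] at h1
  have h3 : ‖(2 / Real.pi : ℝ)‖ₑ * ‖t - j * Real.pi‖ₑ ≤ ‖Real.sin t‖ₑ := by
    rw [← enorm_mul]
    apply enorm_le_iff_norm_le.2
    rw [norm_mul, Real.norm_eq_abs, Real.norm_eq_abs, Real.norm_eq_abs,
      abs_of_pos (div_pos two_pos Real.pi_pos)]
    exact h1
  calc ‖Real.sin t‖ₑ ^ (-s) ≤ (‖(2 / Real.pi : ℝ)‖ₑ * ‖t - j * Real.pi‖ₑ) ^ (-s) :=
        ENNReal.rpow_neg_le_rpow_neg h3 hs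
    _ = ‖(2 / Real.pi : ℝ)‖ₑ ^ (-s) * ‖t - j * Real.pi‖ₑ ^ (-s) :=
        ENNReal.mul_rpow_of_ne_top (by simp) (by simp) _
    _ ≤ _ := by
        gcongr
        exact Finset.single_le_sum (f := fun j : ℤ => ‖t - j * Real.pi‖ₑ ^ (-s))
          (fun _ _ => zero_le) hj

theorem lintegral_enorm_sin_rpow_lt_top {s : ℝ} (hs0 : 0 ≤ s) (hs : s < 1) :
    ∫⁻ t in Set.Ioc (-(2 * Real.pi)) (2 * Real.pi), ‖Real.sin t‖ₑ ^ (-s) < ⊤ := by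
  have hpi := Real.pi_pos
  have h1 : ∫⁻ t in Set.Ioc (-(2 * Real.pi)) (2 * Real.pi), ‖Real.sin t‖ₑ ^ (-s) ≤
      ∫⁻ t in Set.Ioc (-(2 * Real.pi)) (2 * Real.pi), ‖(2 / Real.pi : ℝ)‖ₑ ^ (-s) *
      ∑ j ∈ Finset.Icc (-2 : ℤ) 2, ‖t - j * Real.pi‖ₑ ^ (-s) :=
    setLIntegral_mono (by fun_prop) fun t ht => enorm_sin_rpow_le hs0 (abs_le.2 ⟨ht.1.le, ht.2⟩)
  refine h1.trans_lt ?_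
  rw [lintegral_const_mul _ (by fun_prop), lintegral_finsetSum _ (by fun_prop)]
  refine ENNReal.mul_lt_top ?_ (ENNReal.sum_lt_top.2 fun j hj => ?_)
  · rw [lt_top_iff_ne_top]
    simp [ENNReal.rpow_eq_top_iff, hpi.ne']
  · rw [Finset.mem_Icc] at hj
    have h2 := (measurePreserving_sub_right volume (j * Real.pi)).setLIntegral_comp_preimage
      (s := Set.Ioc (-(4 * Real.pi)) (4 * Real.pi)) measurableSet_Ioc
      (f := fun t : ℝ => ‖t‖ₑ ^ (-s)) (by fun_prop)
    refine lt_of_le_of_lt (lintegral_mono_set ?_)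
      (h2.trans_lt (lintegral_enorm_rpow_lt_top hs _))
    intro t ht
    have h3 : (j : ℝ) ≤ 2 := by exact_mod_cast hj.2
    have h4 : (-2 : ℝ) ≤ j := by exact_mod_cast hj.1
    constructor <;> nlinarith [ht.1, ht.2]

/-- Averages over all directions of a Riesz kernel of a projection. -/
theorem exists_lintegral_lineProj_rpow_le {s : ℝ} (hs0 : 0 < s) (hs : s < 1) :
    ∃ C : ℝ≥0∞, C ≠ ⊤ ∧ ∀ z : Plane, ∫⁻ θ, ‖lineProj θ z‖ₑ ^ (-s) ∂arc ≤ C * ‖z‖ₑ ^ (-s) := by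
  have hpi := Real.pi_pos
  refine ⟨(∫⁻ t in Set.Ioc (-(2 * Real.pi)) (2 * Real.pi), ‖Real.sin t‖ₑ ^ (-s)) + 1,
    ENNReal.add_ne_top.2 ⟨(lintegral_enorm_sin_rpow_lt_top hs0.le hs).ne, by simp⟩, fun z => ?_⟩
  rcases eq_or_ne z 0 with rfl | hz
  · simp [ENNReal.zero_rpow_of_neg (neg_lt_zero.2 hs0)]
  obtain ⟨θ₀, hθ₀, hzθ⟩ := exists_polar z
  have h1 : ∀ θ, ‖lineProj θ z‖ₑ ^ (-s) = ‖z‖ₑ ^ (-s) * ‖Real.sin (θ - θ₀)‖ₑ ^ (-s) := by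
    intro θ
    rw [hzθ, lineProj_smul_dir, enorm_mul, enorm_norm, ← hzθ,
      ENNReal.mul_rpow_of_ne_top (by simp) (by simp)]
  simp_rw [h1]
  rw [lintegral_const_mul _ (by fun_prop), mul_comm]
  gcongr
  refine le_trans ?_ le_self_add
  have h2 := (measurePreserving_sub_right volume θ₀).setLIntegral_comp_preimage
      (s := Set.Ioc (-(2 * Real.pi)) (2 * Real.pi)) measurableSet_Ioc
      (f := fun t : ℝ => ‖Real.sin t‖ₑ ^ (-s)) (by fun_prop)
  rw [← h2]
  apply lintegral_mono_set
  intro t ht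
  constructor <;> linarith [ht.1, ht.2, hθ₀.1, hθ₀.2]

theorem integrable_comp_sub_prod {W : Type*} [MeasurableSpace W] {m : Measure W}
    [IsFiniteMeasure m] {φ : ℝ → ℝ} (hφc : Continuous φ) (hφ : Integrable φ) {a : W → ℝ}
    (ha : Measurable a) : Integrable (fun p : W × ℝ => φ (a p.1 - p.2)) (m.prod volume) := by
  have hm : Measurable fun p : W × ℝ => φ (a p.1 - p.2) :=
    hφc.measurable.comp ((ha.comp measurable_fst).sub measurable_snd)
  rw [integrable_prod_iff hm.aestronglyMeasurable]
  refine ⟨ae_of_all _ fun w => hφ.comp_sub_left (a w), ?_⟩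
  have : ∀ w, ∫ t, ‖φ (a w - t)‖ = ∫ t, ‖φ t‖ := fun w =>
    integral_sub_left_eq_self (fun t => ‖φ t‖) volume (a w)
  simp only [this]
  exact integrable_const _

/-- The `G`-weighted density at scale `φ` of the projection of `α` in direction `q.1`. -/
noncomputable def slice (α : Measure Plane) (G : Plane × ℝ → ℝ) (φ : ℝ → ℝ) (q : ℝ × ℝ) : ℝ :=
  ∫ x, G (x, q.1) * φ (lineProj q.1 x - q.2) ∂α

/-- The correlation of two weighted projections over all directions, for a pair of points. -/
noncomputable def arcCorr (G₁ G₂ : Plane × ℝ → ℝ) (φ ψ : ℝ → ℝ) (p : Plane × Plane) : ℝ :=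
  ∫ θ, G₁ (p.1, θ) * G₂ (p.2, θ) * corr φ ψ (lineProj θ p.1) (lineProj θ p.2) ∂arc

section Fubini

variable {α β : Measure Plane} [IsFiniteMeasure α] [IsFiniteMeasure β] {G₁ G₂ : Plane × ℝ → ℝ}
  {φ ψ : ℝ → ℝ} {M : ℝ}

theorem integrable_weighted_mul {W : Type*} [MeasurableSpace W] {m : Measure W}
    [IsFiniteMeasure m] (hφc : Continuous φ) (hφ : Integrable φ) (hψ : Continuous ψ)
    (hM : ∀ t, |ψ t| ≤ M) {a b g h : W → ℝ} (ha : Measurable a) (hb : Measurable b)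
    (hg : Measurable g) (hh : Measurable h) (hg1 : ∀ w, |g w| ≤ 1) (hh1 : ∀ w, |h w| ≤ 1) :
    Integrable (fun p : W × ℝ => (g p.1 * φ (a p.1 - p.2)) * (h p.1 * ψ (b p.1 - p.2)))
      (m.prod volume) := by
  refine Integrable.mul_bdd (c := 1 * M) ?_ ?_ (ae_of_all _ fun p => ?_)
  · exact (integrable_comp_sub_prod hφc hφ ha).bdd_mul (c := 1)
      (hg.comp measurable_fst).aestronglyMeasurable
      (ae_of_all _ fun p => hg1 _)
  · exact ((hh.comp measurable_fst).mul (hψ.measurable.comp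
      ((hb.comp measurable_fst).sub measurable_snd))).aestronglyMeasurable
  · rw [norm_mul]
    exact mul_le_mul (hh1 _) (hM _) (norm_nonneg _) zero_le_one

theorem measurable_lineProj {W : Type*} [MeasurableSpace W] {f : W → ℝ} {g : W → Plane}
    (hf : Measurable f) (hg : Measurable g) : Measurable fun w => lineProj (f w) (g w) :=
  continuous_lineProj.measurable.comp (hf.prodMk hg)

theorem integrable_arcCorr_integrand (hφc : Continuous φ) (hφ : Integrable φ) (hψ : Continuous ψ)
    (hM : ∀ t, |ψ t| ≤ M) (hG₁ : Measurable G₁) (hG₂ : Measurable G₂)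
    (h₁ : ∀ w, |G₁ w| ≤ 1) (h₂ : ∀ w, |G₂ w| ≤ 1) (p : Plane × Plane) :
    Integrable (fun θ => G₁ (p.1, θ) * G₂ (p.2, θ) *
      corr φ ψ (lineProj θ p.1) (lineProj θ p.2)) arc := by
  have := (integrable_weighted_mul (m := arc) hφc hφ hψ hM
    (a := fun θ => lineProj θ p.1) (b := fun θ => lineProj θ p.2)
    (g := fun θ => G₁ (p.1, θ)) (h := fun θ => G₂ (p.2, θ))
    (measurable_lineProj measurable_id measurable_const)
    (measurable_lineProj measurable_id measurable_const)
    (by fun_prop) (by fun_prop) (fun _ => h₁ _) (fun _ => h₂ _)).integral_prod_left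
  refine this.congr (ae_of_all _ fun θ => ?_)
  simp only [corr]
  rw [← integral_const_mul]
  congr 1; ext t; ring

theorem integral_slice_mul_slice (hφc : Continuous φ) (hφ : Integrable φ) (hψ : Continuous ψ)
    (hM : ∀ t, |ψ t| ≤ M) (hG₁ : Measurable G₁) (hG₂ : Measurable G₂)
    (h₁ : ∀ w, |G₁ w| ≤ 1) (h₂ : ∀ w, |G₂ w| ≤ 1) :
    Integrable (fun q => slice α G₁ φ q * slice β G₂ ψ q) (arc.prod volume) ∧
    Integrable (arcCorr G₁ G₂ φ ψ) (α.prod β) ∧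
    ∫ q, slice α G₁ φ q * slice β G₂ ψ q ∂(arc.prod volume)
      = ∫ p, arcCorr G₁ G₂ φ ψ p ∂(α.prod β) := by
  set F : (Plane × Plane) → (ℝ × ℝ) → ℝ := fun p q =>
    (G₁ (p.1, q.1) * φ (lineProj q.1 p.1 - q.2)) * (G₂ (p.2, q.1) * ψ (lineProj q.1 p.2 - q.2))
    with hF
  have hint : Integrable (Function.uncurry F) ((α.prod β).prod (arc.prod volume)) := by
    have h := integrable_weighted_mul (m := (α.prod β).prod arc) hφc hφ hψ hM
      (a := fun w => lineProj w.2 w.1.1) (b := fun w => lineProj w.2 w.1.2)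
      (g := fun w => G₁ (w.1.1, w.2)) (h := fun w => G₂ (w.1.2, w.2))
      (measurable_lineProj (by fun_prop) (by fun_prop))
      (measurable_lineProj (by fun_prop) (by fun_prop))
      (by fun_prop) (by fun_prop) (fun _ => h₁ _) (fun _ => h₂ _)
    have hp := (measurePreserving_prodAssoc (α.prod β) arc (volume : Measure ℝ))
    exact (hp.integrable_comp_emb MeasurableEquiv.prodAssoc.measurableEmbedding).1 h
  have e1 : ∀ q, slice α G₁ φ q * slice β G₂ ψ q = ∫ p, F p q ∂(α.prod β) := fun q =>
    (integral_prod_mul (fun x => G₁ (x, q.1) * φ (lineProj q.1 x - q.2))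
      (fun x => G₂ (x, q.1) * ψ (lineProj q.1 x - q.2))).symm
  have e2 : ∀ p, arcCorr G₁ G₂ φ ψ p = ∫ q, F p q ∂(arc.prod volume) := by
    intro p
    have := (integrable_weighted_mul (m := arc) hφc hφ hψ hM
      (a := fun θ => lineProj θ p.1) (b := fun θ => lineProj θ p.2)
      (g := fun θ => G₁ (p.1, θ)) (h := fun θ => G₂ (p.2, θ))
      (measurable_lineProj measurable_id measurable_const)
      (measurable_lineProj measurable_id measurable_const)
      (by fun_prop) (by fun_prop) (fun _ => h₁ _) (fun _ => h₂ _))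
    rw [integral_prod _ this]
    unfold arcCorr
    congr 1; ext θ
    simp only [corr]
    rw [← integral_const_mul]
    congr 1; ext t; ring
  refine ⟨?_, ?_, ?_⟩
  · simp only [e1]
    exact hint.integral_prod_right
  · exact hint.integral_prod_left.congr (ae_of_all _ fun p => (e2 p).symm)
  · simp only [e1, e2]
    exact (integral_integral_swap hint).symm

end Fubini

theorem integrable_slice_integrand {α : Measure Plane} [IsFiniteMeasure α] {G : Plane × ℝ → ℝ}
    {φ : ℝ → ℝ} {M : ℝ} (hφ : Continuous φ) (hM : ∀ t, |φ t| ≤ M) (hG : Measurable G)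
    (h : ∀ w, |G w| ≤ 1) (q : ℝ × ℝ) :
    Integrable (fun x => G (x, q.1) * φ (lineProj q.1 x - q.2)) α := by
  refine Integrable.of_bound (C := 1 * M) ?_ (ae_of_all _ fun x => ?_)
  · exact ((by fun_prop : Measurable fun x => G (x, q.1)).mul (hφ.measurable.comp
      ((measurable_lineProj measurable_const measurable_id).sub_const _))).aestronglyMeasurable
  · rw [norm_mul]
    exact mul_le_mul (h _) (hM _) (norm_nonneg _) zero_le_one

theorem abs_tent_le {r : ℝ} (hr : 0 < r) (t : ℝ) : |tent r t| ≤ 1 / r := by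
  rw [abs_of_nonneg (tent_nonneg hr t)]; exact tent_le hr t

theorem slice_tentSum {α : Measure Plane} [IsFiniteMeasure α] {G : Plane × ℝ → ℝ} {r : ℝ}
    (hr : 0 < r) (hG : Measurable G) (h : ∀ w, |G w| ≤ 1) (q : ℝ × ℝ) :
    slice α G (tentSum r) q = slice α G (tent (r / 2)) q + slice α G (tent r) q := by
  unfold slice
  rw [← integral_add
    (integrable_slice_integrand (continuous_tent _) (abs_tent_le (half_pos hr)) hG h q)
    (integrable_slice_integrand (continuous_tent _) (abs_tent_le hr) hG h q)]
  simp only [tentSum, mul_add]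

theorem slice_tentDiff {α : Measure Plane} [IsFiniteMeasure α] {G : Plane × ℝ → ℝ} {r : ℝ}
    (hr : 0 < r) (hG : Measurable G) (h : ∀ w, |G w| ≤ 1) (q : ℝ × ℝ) :
    slice α G (tentDiff r) q = slice α G (tent (r / 2)) q - slice α G (tent r) q := by
  unfold slice
  rw [← integral_sub
    (integrable_slice_integrand (continuous_tent _) (abs_tent_le (half_pos hr)) hG h q)
    (integrable_slice_integrand (continuous_tent _) (abs_tent_le hr) hG h q)]
  simp only [tentDiff, mul_sub]

/-- The smoothed incidence form between `ν` and the `G`-weighted `μ` at scale `r`. -/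
noncomputable def incidence (ν μ : Measure Plane) (G : Plane × ℝ → ℝ) (r : ℝ) : ℝ :=
  ∫ p, arcCorr (fun _ => 1) G (tent r) (tent r) p ∂(ν.prod μ)

theorem incidence_half_le {ν μ : Measure Plane} [IsFiniteMeasure ν] [IsFiniteMeasure μ]
    {G : Plane × ℝ → ℝ} (hG : Measurable G) (h : ∀ w, |G w| ≤ 1) {r c : ℝ} (hr : 0 < r)
    (hc : 0 < c) :
    incidence ν μ G (r / 2) ≤ incidence ν μ G r
      + (c * (∫ p, arcCorr (fun _ => 1) (fun _ => 1) (tentDiff r) (tentDiff r) p ∂(ν.prod ν))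
      + c⁻¹ * (∫ p, arcCorr G G (tentSum r) (tentSum r) p ∂(μ.prod μ))) / 2 := by
  have h2 := half_pos hr
  have h1 : ∀ w : Plane × ℝ, |(1 : ℝ)| ≤ 1 := by simp
  have key : ∀ {p q : ℝ}, 0 < p → 0 < q → _ := fun {p q : ℝ} hp hq =>
    integral_slice_mul_slice (α := ν) (β := μ) (continuous_tent p) (integrable_tent hp)
      (continuous_tent q) (abs_tent_le hq) measurable_const hG h1 h
  obtain ⟨i1, -, k1⟩ := key hr hr
  obtain ⟨i2, -, k2⟩ := key h2 h2
  obtain ⟨i3, -, k3⟩ := key hr h2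
  obtain ⟨i4, -, k4⟩ := key h2 hr
  obtain ⟨i5, -, k5⟩ := integral_slice_mul_slice (α := ν) (β := ν) (continuous_tentDiff r)
    (integrable_tentDiff hr) (continuous_tentDiff r) (abs_tentDiff_le hr) measurable_const
    measurable_const h1 h1
  obtain ⟨i6, -, k6⟩ := integral_slice_mul_slice (α := μ) (β := μ) (continuous_tentSum r)
    (integrable_tentSum hr) (continuous_tentSum r) (abs_tentSum_le hr) hG hG h h
  have hsym : arcCorr (fun _ => 1) G (tent r) (tent (r / 2))
      = arcCorr (fun _ => 1) G (tent (r / 2)) (tent r) := by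
    unfold arcCorr
    ext p; congr 1; ext θ
    rw [corr_comm_of_even (tent_neg _) (tent_neg _)]
  rw [hsym, ← k4] at k3
  unfold incidence
  rw [← k1, ← k2, ← k5, ← k6, ← integral_const_mul, ← integral_const_mul,
    ← integral_add (i5.const_mul _) (i6.const_mul _), ← integral_div]
  have hmono := integral_mono ((i2.sub i3).add (i4.sub i1))
    (((i5.const_mul c).add (i6.const_mul c⁻¹)).div_const 2) (fun q => by
      simp only [Pi.add_apply, Pi.sub_apply]
      rw [slice_tentSum hr hG h q, slice_tentDiff hr measurable_const h1 q]
      set a := slice ν (fun _ => 1) (tent (r / 2)) q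
      set b := slice ν (fun _ => 1) (tent r) q
      set a' := slice μ G (tent (r / 2)) q
      set b' := slice μ G (tent r) q
      have h3 : 0 ≤ c⁻¹ * (c * (a - b) - (a' + b')) ^ 2 := by positivity
      have h4 : c⁻¹ * (c * (a - b) - (a' + b')) ^ 2 = c * ((a - b) * (a - b))
        + c⁻¹ * ((a' + b') * (a' + b')) - 2 * ((a - b) * (a' + b')) := by
        field_simp; ring
      rw [h4] at h3
      show _ ≤ (c * ((a - b) * (a - b)) + c⁻¹ * ((a' + b') * (a' + b'))) / 2
      linarith)
  have hl := integral_add (i2.sub i3) (i4.sub i1)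
  have e1 := integral_sub i2 i3
  have e2 := integral_sub i4 i1
  simp only [Pi.add_apply, Pi.sub_apply] at hl hmono
  linarith

theorem enorm_rpow_neg_of_ne_zero {a : ℝ} (ha : a ≠ 0) (s : ℝ) :
    ‖a‖ₑ ^ (-s) = ENNReal.ofReal (|a| ^ (-s)) := by
  rw [← ofReal_norm, ENNReal.ofReal_rpow_of_pos (norm_pos_iff.2 ha), Real.norm_eq_abs]

theorem enorm_le_ofReal_mul_rpow {v c a s : ℝ} (hc : 0 < c) (hs : 0 < s)
    (h : a ≠ 0 → |v| ≤ c * |a| ^ (-s)) : ‖v‖ₑ ≤ ENNReal.ofReal c * ‖a‖ₑ ^ (-s) := by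
  rcases eq_or_ne a 0 with rfl | ha
  · have : ENNReal.ofReal c ≠ 0 := by simpa using hc
    simp [ENNReal.zero_rpow_of_neg (neg_lt_zero.2 hs), ENNReal.mul_top this]
  · rw [enorm_rpow_neg_of_ne_zero ha, ← ENNReal.ofReal_mul hc.le, ← ofReal_norm]
    exact ENNReal.ofReal_le_ofReal (h ha)

theorem enorm_arcCorr_tentDiff_le {r u : ℝ} (hr : 0 < r) (hu0 : 0 < u) (hu : u ≤ 2)
    (p : Plane × Plane) :
    ‖arcCorr (fun _ => 1) (fun _ => 1) (tentDiff r) (tentDiff r) p‖ₑ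
      ≤ ENNReal.ofReal (2400 * r ^ (u - 1)) * edist p.1 p.2 ^ (-u) := by
  rw [edist_comm, edist_eq_enorm_sub, ← enorm_norm (p.2 - p.1)]
  refine enorm_le_ofReal_mul_rpow (by positivity) hu0 fun hz => ?_
  obtain ⟨θ₀, -, hθ⟩ := exists_polar (p.2 - p.1)
  have : ∀ θ, corr (tentDiff r) (tentDiff r) (lineProj θ p.1) (lineProj θ p.2)
      = corr (tentDiff r) (tentDiff r) 0 (‖p.2 - p.1‖ * Real.sin (θ - θ₀)) := by
    intro θ
    rw [corr_translate, ← lineProj_sub, ← lineProj_smul_dir, ← hθ]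
  simp only [arcCorr, this, mul_one, one_mul, abs_norm]
  rw [mul_assoc]
  exact abs_integral_corr_tentDiff_le hr ((norm_nonneg _).lt_of_ne' hz) hu0.le hu θ₀

theorem lintegral_edist_rpow_eq_energy {ν : Measure Plane} [SFinite ν] (u : ℝ) :
    ∫⁻ p, edist p.1 p.2 ^ (-u) ∂(ν.prod ν) = energy u ν :=
  lintegral_prod _ (by fun_prop)

theorem integral_arcCorr_tentDiff_le {ν : Measure Plane} [IsFiniteMeasure ν] {r u : ℝ}
    (hr : 0 < r) (hu0 : 0 < u) (hu : u ≤ 2) (hE : energy u ν ≠ ⊤) :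
    ∫ p, arcCorr (fun _ => 1) (fun _ => 1) (tentDiff r) (tentDiff r) p ∂(ν.prod ν)
      ≤ 2400 * r ^ (u - 1) * (energy u ν).toReal := by
  have h : ‖∫ p, arcCorr (fun _ => 1) (fun _ => 1) (tentDiff r) (tentDiff r) p ∂(ν.prod ν)‖ₑ
      ≤ ENNReal.ofReal (2400 * r ^ (u - 1)) * energy u ν := by
    refine (enorm_integral_le_lintegral_enorm _).trans ?_
    rw [← lintegral_edist_rpow_eq_energy, ← lintegral_const_mul _ (by fun_prop)]
    exact lintegral_mono fun p => enorm_arcCorr_tentDiff_le hr hu0 hu p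
  have h2 := ENNReal.toReal_mono (ENNReal.mul_ne_top ENNReal.ofReal_ne_top hE) h
  rw [toReal_enorm, ENNReal.toReal_mul, ENNReal.toReal_ofReal (by positivity)] at h2
  exact (le_abs_self _).trans h2

theorem enorm_corr_tentSum_le {r s : ℝ} (hr : 0 < r) (hs0 : 0 < s) (hs : s ≤ 1) (a b : ℝ) :
    ‖corr (tentSum r) (tentSum r) a b‖ₑ
      ≤ ENNReal.ofReal (36 * r ^ (s - 1)) * ‖a - b‖ₑ ^ (-s) := by
  refine enorm_le_ofReal_mul_rpow (by positivity) hs0 fun hab => ?_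
  have hpos : 0 < |a - b| := abs_pos.2 hab
  rcases le_or_gt (2 * r) |a - b| with h | h
  · rw [corr_eq_zero (fun _ => tentSum_eq_zero hr) (fun _ => tentSum_eq_zero hr) h, abs_zero]
    positivity
  · refine (abs_corr_le hr (abs_tentSum_le hr) (fun _ => tentSum_eq_zero hr)
      (abs_tentSum_le hr) a b).trans ?_
    have h2 : 1 / 2 * r ^ (-s) ≤ |a - b| ^ (-s) := by
      calc 1 / 2 * r ^ (-s) ≤ 2 ^ (-s) * r ^ (-s) := by
            gcongr
            calc (1 / 2 : ℝ) = 2 ^ (-1 : ℝ) := by rw [Real.rpow_neg_one]; norm_num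
              _ ≤ 2 ^ (-s) := Real.rpow_le_rpow_of_exponent_le (by norm_num) (by linarith)
        _ = (2 * r) ^ (-s) := (Real.mul_rpow (by norm_num) hr.le).symm
        _ ≤ _ := Real.rpow_le_rpow_of_nonpos hpos h.le (by linarith)
    calc 2 * r * (3 / r) ^ 2 = 36 * r ^ (s - 1) * (1 / 2 * r ^ (-s)) := by
          have : r ^ (s - 1) * r ^ (-s) = r⁻¹ := by
            rw [← Real.rpow_add hr, ← Real.rpow_neg_one]; ring_nf
          rw [show 36 * r ^ (s - 1) * (1 / 2 * r ^ (-s)) = 18 * (r ^ (s - 1) * r ^ (-s)) by ring,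
            this]
          field_simp; norm_num
      _ ≤ _ := by gcongr

/-- The Riesz potential of the projection of `μ` in direction `q.2`, at the point `q.1`. -/
noncomputable def projPotential (s : ℝ) (μ : Measure Plane) (q : Plane × ℝ) : ℝ≥0∞ :=
  ∫⁻ y, ‖lineProj q.2 q.1 - lineProj q.2 y‖ₑ ^ (-s) ∂μ

theorem measurable_riesz (s : ℝ) :
    Measurable fun w : (Plane × ℝ) × Plane => ‖lineProj w.1.2 w.1.1 - lineProj w.1.2 w.2‖ₑ ^ (-s) :=
  (((measurable_lineProj (by fun_prop) (by fun_prop)).sub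
    (measurable_lineProj (by fun_prop) (by fun_prop))).enorm).pow_const _

theorem measurable_projPotential (s : ℝ) (μ : Measure Plane) [SFinite μ] :
    Measurable (projPotential s μ) :=
  (measurable_riesz s).lintegral_prod_right'

theorem lintegral_projPotential_ne_top {s : ℝ} (hs0 : 0 < s) (hs : s < 1) {μ : Measure Plane}
    [IsFiniteMeasure μ] (hE : energy s μ ≠ ⊤) :
    ∫⁻ q, projPotential s μ q ∂(μ.prod arc) ≠ ⊤ := by
  obtain ⟨C, hC, h⟩ := exists_lintegral_lineProj_rpow_le hs0 hs
  rw [lintegral_prod _ (measurable_projPotential s μ).aemeasurable]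
  have h1 : ∀ x, ∫⁻ θ, projPotential s μ (x, θ) ∂arc ≤ C * ∫⁻ y, edist x y ^ (-s) ∂μ := by
    intro x
    unfold projPotential
    rw [lintegral_lintegral_swap (f := fun θ y => ‖lineProj θ x - lineProj θ y‖ₑ ^ (-s))
      ((measurable_riesz s).comp
        (by fun_prop : Measurable fun p : ℝ × Plane => ((x, p.1), p.2))).aemeasurable,
      ← lintegral_const_mul _ (by fun_prop)]
    refine lintegral_mono fun y => ?_
    simp only [← lineProj_sub, edist_eq_enorm_sub]
    exact h _
  refine ne_top_of_le_ne_top ?_ (lintegral_mono h1)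
  rw [lintegral_const_mul _ (Measurable.lintegral_prod_right' (f := fun p : Plane × Plane =>
    edist p.1 p.2 ^ (-s)) (by fun_prop))]
  exact ENNReal.mul_ne_top hC hE

theorem enorm_indicator_one_eq {X : Type*} (U : Set X) (w : X) :
    ‖U.indicator (1 : X → ℝ) w‖ₑ = U.indicator 1 w := by
  by_cases h : w ∈ U <;> simp [h]

theorem enorm_indicator_one_le (U : Set (Plane × ℝ)) (w : Plane × ℝ) :
    ‖U.indicator (1 : Plane × ℝ → ℝ) w‖ₑ ≤ 1 := by
  by_cases h : w ∈ U <;> simp [h]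

theorem lintegral_prod_lintegral_mul_eq {X Y Z : Type*} [MeasurableSpace X] [MeasurableSpace Y]
    [MeasurableSpace Z] {α : Measure X} {β : Measure Y} {γ : Measure Z} [SFinite α] [SFinite β]
    [SFinite γ] {g : X × Z → ℝ≥0∞} {k : X × Z → Y → ℝ≥0∞} (hg : Measurable g)
    (hk : Measurable (Function.uncurry k)) :
    ∫⁻ p, ∫⁻ θ, g (p.1, θ) * k (p.1, θ) p.2 ∂γ ∂(α.prod β)
      = ∫⁻ q, g q * ∫⁻ y, k q y ∂β ∂(α.prod γ) := by
  have h1 : Measurable fun w : (X × Y) × Z => g (w.1.1, w.2) * k (w.1.1, w.2) w.1.2 :=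
    (hg.comp (by fun_prop)).mul
      (hk.comp (by fun_prop : Measurable fun w : (X × Y) × Z => ((w.1.1, w.2), w.1.2)))
  rw [lintegral_prod _ h1.lintegral_prod_right'.aemeasurable,
    lintegral_prod (fun q => g q * ∫⁻ y, k q y ∂β)
      (hg.mul hk.lintegral_prod_right').aemeasurable]
  refine lintegral_congr fun x => ?_
  have h2 : Measurable fun p : Y × Z => g (x, p.2) * k (x, p.2) p.1 :=
    h1.comp (by fun_prop : Measurable fun p : Y × Z => ((x, p.1), p.2))
  rw [lintegral_lintegral_swap (f := fun y θ => g (x, θ) * k (x, θ) y) h2.aemeasurable]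
  refine lintegral_congr fun θ => ?_
  exact lintegral_const_mul _ (hk.comp measurable_prodMk_left)

theorem integral_arcCorr_tentSum_le {μ : Measure Plane} [IsFiniteMeasure μ] {r s : ℝ}
    (hr : 0 < r) (hs0 : 0 < s) (hs : s ≤ 1) {U : Set (Plane × ℝ)} (hU : MeasurableSet U)
    (hI : ∫⁻ q in U, projPotential s μ q ∂(μ.prod arc) ≠ ⊤) :
    ∫ p, arcCorr (U.indicator 1) (U.indicator 1) (tentSum r) (tentSum r) p ∂(μ.prod μ)
      ≤ 36 * r ^ (s - 1) * (∫⁻ q in U, projPotential s μ q ∂(μ.prod arc)).toReal := by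
  set c := ENNReal.ofReal (36 * r ^ (s - 1)) with hc
  set k : (Plane × ℝ) → Plane → ℝ≥0∞ := fun q y =>
    ‖lineProj q.2 q.1 - lineProj q.2 y‖ₑ ^ (-s) with hk
  have hkm : Measurable (Function.uncurry k) := measurable_riesz s
  have h1U : Measurable (U.indicator (1 : Plane × ℝ → ℝ≥0∞)) := measurable_one.indicator hU
  have h : ‖∫ p, arcCorr (U.indicator 1) (U.indicator 1) (tentSum r) (tentSum r) p ∂(μ.prod μ)‖ₑ
      ≤ c * ∫⁻ q in U, projPotential s μ q ∂(μ.prod arc) := by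
    calc _ ≤ ∫⁻ p, ∫⁻ θ, (c * U.indicator 1 (p.1, θ)) * k (p.1, θ) p.2 ∂arc ∂(μ.prod μ) := by
          refine (enorm_integral_le_lintegral_enorm _).trans (lintegral_mono fun p => ?_)
          refine (enorm_integral_le_lintegral_enorm _).trans (lintegral_mono fun θ => ?_)
          rw [enorm_mul, enorm_mul]
          have h1 := enorm_corr_tentSum_le hr hs0 hs (lineProj θ p.1) (lineProj θ p.2)
          calc _ ≤ U.indicator 1 (p.1, θ) * 1 * (c * k (p.1, θ) p.2) :=
                mul_le_mul' (mul_le_mul' (enorm_indicator_one_eq U _).le (enorm_indicator_one_le U _)) h1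
            _ = _ := by ring
      _ = ∫⁻ q, (c * U.indicator 1 q) * ∫⁻ y, k q y ∂μ ∂(μ.prod arc) :=
          lintegral_prod_lintegral_mul_eq (h1U.const_mul c) hkm
      _ = ∫⁻ q, c * U.indicator (projPotential s μ) q ∂(μ.prod arc) := by
          refine lintegral_congr fun q => ?_
          by_cases hm : q ∈ U <;> simp [hm, projPotential, hk]
      _ = _ := by
          rw [lintegral_const_mul _ ((measurable_projPotential s μ).indicator hU),
            lintegral_indicator hU]
  have h2 := ENNReal.toReal_mono (ENNReal.mul_ne_top ENNReal.ofReal_ne_top hI) h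
  rw [toReal_enorm, ENNReal.toReal_mul, ENNReal.toReal_ofReal (by positivity)] at h2
  exact (le_abs_self _).trans h2

theorem incidence_one_le {ν μ : Measure Plane} [IsProbabilityMeasure ν] [IsFiniteMeasure μ]
    {U : Set (Plane × ℝ)} (hU : MeasurableSet U) :
    incidence ν μ (U.indicator 1) 1 ≤ 2 * ((μ.prod arc) U).toReal := by
  have h1U : Measurable (U.indicator (1 : Plane × ℝ → ℝ≥0∞)) := measurable_one.indicator hU
  have h : ‖incidence ν μ (U.indicator 1) 1‖ₑ ≤ 2 * (μ.prod arc) U := by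
    calc _ ≤ ∫⁻ p, ∫⁻ θ, 2 * U.indicator 1 (p.2, θ) ∂arc ∂(ν.prod μ) := by
          refine (enorm_integral_le_lintegral_enorm _).trans (lintegral_mono fun p => ?_)
          refine (enorm_integral_le_lintegral_enorm _).trans (lintegral_mono fun θ => ?_)
          rw [one_mul, enorm_mul, mul_comm]
          have h1 : ‖corr (tent 1) (tent 1) (lineProj θ p.1) (lineProj θ p.2)‖ₑ ≤ 2 := by
            rw [← ofReal_norm, Real.norm_eq_abs]
            refine (ENNReal.ofReal_le_ofReal (abs_corr_le one_pos (abs_tent_le one_pos)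
              (fun _ => tent_eq_zero one_pos) (abs_tent_le one_pos) _ _)).trans ?_
            norm_num
          exact mul_le_mul' h1 (enorm_indicator_one_eq U _).le
      _ = ∫⁻ y, ∫⁻ x, ∫⁻ θ, 2 * U.indicator 1 (x, θ) ∂arc ∂μ ∂ν :=
          lintegral_prod _ (Measurable.lintegral_prod_right'
            (f := fun w : (Plane × Plane) × ℝ => 2 * U.indicator (1 : Plane × ℝ → ℝ≥0∞) (w.1.2, w.2))
            ((h1U.comp (by fun_prop)).const_mul 2)).aemeasurable
      _ = ∫⁻ q, 2 * U.indicator 1 q ∂(μ.prod arc) := by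
          rw [lintegral_const, measure_univ, mul_one,
            lintegral_prod _ (h1U.const_mul 2).aemeasurable]
      _ = _ := by
          rw [lintegral_const_mul _ h1U, lintegral_indicator_one hU]
  have h2 := ENNReal.toReal_mono (ENNReal.mul_ne_top (by simp) (measure_ne_top _ U)) h
  rw [toReal_enorm, ENNReal.toReal_mul] at h2
  exact (le_abs_self _).trans (by simpa using h2)

theorem energy_ne_top_of_le {μ : Measure Plane} [IsFiniteMeasure μ] {s t : ℝ} (hs : 0 ≤ s)
    (hst : s ≤ t) (hE : energy t μ ≠ ⊤) : energy s μ ≠ ⊤ := by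
  have h : ∀ d : ℝ≥0∞, d ^ (-s) ≤ d ^ (-t) + 1 := by
    intro d
    rcases le_total d 1 with hd | hd
    · exact (ENNReal.rpow_le_rpow_of_exponent_ge hd (by linarith)).trans le_self_add
    · have := ENNReal.rpow_neg_le_rpow_neg hd hs
      rw [ENNReal.one_rpow] at this
      exact this.trans le_add_self
  rw [← lintegral_edist_rpow_eq_energy] at hE ⊢
  refine ne_top_of_le_ne_top ?_ (lintegral_mono fun p : Plane × Plane => h (edist p.1 p.2))
  rw [lintegral_add_right _ measurable_const]
  exact ENNReal.add_ne_top.2 ⟨hE, by simp [measure_ne_top]⟩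

theorem abs_indicator_one_le {X : Type*} (U : Set X) (w : X) :
    |U.indicator (1 : X → ℝ) w| ≤ 1 := by
  by_cases h : w ∈ U <;> simp [h]

theorem incidence_half_le_add {ν μ : Measure Plane} [IsFiniteMeasure ν] [IsFiniteMeasure μ]
    {s u ε r : ℝ} (hs0 : 0 < s) (hs : s ≤ 1) (hu0 : 0 < u) (hu : u ≤ 2) (hε : 0 < ε) (hr : 0 < r)
    (hE : energy u ν ≠ ⊤) {U : Set (Plane × ℝ)} (hU : MeasurableSet U)
    (hI : ∫⁻ q in U, projPotential s μ q ∂(μ.prod arc) ≠ ⊤) :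
    incidence ν μ (U.indicator 1) (r / 2) ≤ incidence ν μ (U.indicator 1) r
      + r ^ ((u + s - 2) / 2) * (1200 * ε * (energy u ν).toReal
        + 18 * ε⁻¹ * (∫⁻ q in U, projPotential s μ q ∂(μ.prod arc)).toReal) := by
  have hc : 0 < ε * r ^ ((s - u) / 2) := by positivity
  refine (incidence_half_le (measurable_one.indicator hU) (abs_indicator_one_le U) hr hc).trans ?_
  have h1 := mul_le_mul_of_nonneg_left (integral_arcCorr_tentDiff_le (ν := ν) hr hu0 hu hE) hc.le
  have h2 := mul_le_mul_of_nonneg_left (integral_arcCorr_tentSum_le (μ := μ) hr hs0 hs hU hI)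
    (inv_pos.2 hc).le
  have e1 : r ^ ((s - u) / 2) * r ^ (u - 1) = r ^ ((u + s - 2) / 2) := by
    rw [← Real.rpow_add hr]; ring_nf
  have e2 : (r ^ ((s - u) / 2))⁻¹ * r ^ (s - 1) = r ^ ((u + s - 2) / 2) := by
    rw [← Real.rpow_neg hr.le, ← Real.rpow_add hr]; ring_nf
  rw [mul_inv] at h2 ⊢
  set E := (energy u ν).toReal
  set I := (∫⁻ q in U, projPotential s μ q ∂(μ.prod arc)).toReal
  rw [show ε * r ^ ((s - u) / 2) * (2400 * r ^ (u - 1) * E)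
    = r ^ ((s - u) / 2) * r ^ (u - 1) * (2400 * ε * E) by ring, e1] at h1
  rw [show ε⁻¹ * (r ^ ((s - u) / 2))⁻¹ * (36 * r ^ (s - 1) * I)
    = (r ^ ((s - u) / 2))⁻¹ * r ^ (s - 1) * (36 * ε⁻¹ * I) by ring, e2] at h2
  linarith

theorem incidence_pow_le {ν μ : Measure Plane} [IsProbabilityMeasure ν] [IsFiniteMeasure μ]
    {s u ε : ℝ} (hs0 : 0 < s) (hs : s ≤ 1) (hu0 : 0 < u) (hu : u ≤ 2) (hsu : 2 < s + u)
    (hε : 0 < ε) (hE : energy u ν ≠ ⊤) {U : Set (Plane × ℝ)} (hU : MeasurableSet U)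
    (hI : ∫⁻ q in U, projPotential s μ q ∂(μ.prod arc) ≠ ⊤) (n : ℕ) :
    incidence ν μ (U.indicator 1) ((1 / 2) ^ n) ≤ 2 * ((μ.prod arc) U).toReal
      + (1 - (1 / 2) ^ ((u + s - 2) / 2))⁻¹ * (1200 * ε * (energy u ν).toReal
        + 18 * ε⁻¹ * (∫⁻ q in U, projPotential s μ q ∂(μ.prod arc)).toReal) := by
  set q : ℝ := (1 / 2) ^ ((u + s - 2) / 2) with hq
  set D := 1200 * ε * (energy u ν).toReal
        + 18 * ε⁻¹ * (∫⁻ q in U, projPotential s μ q ∂(μ.prod arc)).toReal with hD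
  have hq0 : 0 ≤ q := by positivity
  have hq1 : q < 1 := Real.rpow_lt_one (by norm_num) (by norm_num) (by linarith)
  have hD0 : 0 ≤ D := by positivity
  have key : incidence ν μ (U.indicator 1) ((1 / 2) ^ n)
      ≤ 2 * ((μ.prod arc) U).toReal + (∑ i ∈ Finset.range n, q ^ i) * D := by
    induction n with
    | zero => simpa using incidence_one_le hU
    | succ n ih =>
      have h := incidence_half_le_add (r := (1 / 2) ^ n) hs0 hs hu0 hu hε (by positivity) hE hU hI
      have e : ((1 / 2 : ℝ) ^ n) ^ ((u + s - 2) / 2) = q ^ n := by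
        rw [hq, ← Real.rpow_natCast, ← Real.rpow_mul (by norm_num), mul_comm,
          Real.rpow_mul (by norm_num), Real.rpow_natCast]
      rw [e, ← hD] at h
      rw [Finset.sum_range_succ, add_mul, pow_succ, mul_one_div]
      linarith
  refine key.trans ?_
  gcongr
  rw [← tsum_geometric_of_lt_one hq0 hq1]
  exact (summable_geometric_of_lt_one hq0 hq1).sum_le_tsum _ fun i _ => by positivity

theorem arcCorr_tent_nonneg {U : Set (Plane × ℝ)} {r : ℝ} (hr : 0 < r) (p : Plane × Plane) :
    0 ≤ arcCorr (fun _ => 1) (U.indicator 1) (tent r) (tent r) p :=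
  integral_nonneg fun _ => mul_nonneg (mul_nonneg zero_le_one
    (Set.indicator_nonneg (fun _ _ => zero_le_one) _)) (corr_tent_nonneg hr _ _)

theorem eventually_le_arcCorr {U : Set (Plane × ℝ)} (hU : IsOpen U) {x y : Plane} {θ₀ : ℝ}
    (hθ₀ : θ₀ ∈ Set.Ioc (-Real.pi) Real.pi) (hxy : y - x = ‖y - x‖ • dir θ₀)
    (hR : ‖y - x‖ ≤ 2) (hmem : (x, θ₀) ∈ U) :
    ∀ᶠ n : ℕ in Filter.atTop, 3 / 128 ≤
      arcCorr (fun _ => 1) (U.indicator 1) (tent ((1 / 2) ^ n)) (tent ((1 / 2) ^ n)) (y, x) := by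
  have hV : IsOpen ((fun θ : ℝ => (x, θ)) ⁻¹' U ∩ Set.Ioi (-Real.pi)) :=
    (hU.preimage (by fun_prop)).inter isOpen_Ioi
  obtain ⟨δ, hδ, hball⟩ := Metric.isOpen_iff.1 hV θ₀ ⟨hmem, hθ₀.1⟩
  have hlim : Filter.Tendsto (fun n : ℕ => (1 / 2 : ℝ) ^ n) Filter.atTop (nhds 0) :=
    tendsto_pow_atTop_nhds_zero_of_lt_one (by norm_num) (by norm_num)
  filter_upwards [hlim.eventually (gt_mem_nhds hδ)] with n hn
  set r : ℝ := (1 / 2) ^ n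
  have hr : 0 < r := by positivity
  set S := Set.Ioc (θ₀ - r / 8) θ₀ with hS
  have hSV : ∀ θ ∈ S, (x, θ) ∈ U ∧ -Real.pi < θ := fun θ hθ => hball (by
    rw [Metric.mem_ball, Real.dist_eq, abs_lt]; constructor <;> linarith [hθ.1, hθ.2])
  have hSarc : S ⊆ Set.Ioc (-Real.pi) Real.pi := fun θ hθ => ⟨(hSV θ hθ).2, hθ.2.trans hθ₀.2⟩
  have hint := integrable_arcCorr_integrand (G₁ := fun _ => 1) (G₂ := U.indicator 1)
    (continuous_tent r) (integrable_tent hr) (continuous_tent r) (abs_tent_le hr)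
    measurable_const (measurable_one.indicator hU.measurableSet) (by simp)
    (abs_indicator_one_le U) (y, x)
  have hvol : arc.real S = r / 8 := by
    rw [measureReal_def, arc, Measure.restrict_apply measurableSet_Ioc,
      Set.inter_eq_left.2 hSarc, Real.volume_Ioc, ENNReal.toReal_ofReal] <;> linarith
  calc (3 / 128 : ℝ) = ∫ θ in S, 3 / 16 / r ∂arc := by
        rw [setIntegral_const, hvol, smul_eq_mul]; field_simp; norm_num
    _ ≤ ∫ θ in S, 1 * (U.indicator 1 (x, θ)) *
          corr (tent r) (tent r) (lineProj θ y) (lineProj θ x) ∂arc := by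
        refine setIntegral_mono_on (integrable_const _).integrableOn hint.integrableOn
          measurableSet_Ioc fun θ hθ => ?_
        rw [Set.indicator_of_mem (hSV θ hθ).1, Pi.one_apply, one_mul, one_mul]
        refine corr_tent_ge hr ?_
        rw [← lineProj_sub, hxy, lineProj_smul_dir, abs_mul, abs_norm]
        have h1 : |Real.sin (θ - θ₀)| ≤ r / 8 := by
          refine Real.abs_sin_le_abs.trans ?_
          rw [abs_le]; constructor <;> linarith [hθ.1, hθ.2]
        calc _ ≤ 2 * (r / 8) := by gcongr
          _ = r / 4 := by ring
    _ ≤ _ := setIntegral_le_integral hint (ae_of_all _ fun θ => mul_nonneg (mul_nonneg zero_le_one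
        (Set.indicator_nonneg (fun _ _ => zero_le_one) _)) (corr_tent_nonneg hr _ _))

theorem measure_le_of_eventually_le_arcCorr {ν μ : Measure Plane} [IsFiniteMeasure ν]
    [IsFiniteMeasure μ] {U : Set (Plane × ℝ)} (hU : MeasurableSet U) {B : Set (Plane × Plane)}
    (hB : MeasurableSet B) {a K : ℝ}
    (hle : ∀ p ∈ B, ∀ᶠ n : ℕ in Filter.atTop, a ≤
      arcCorr (fun _ => 1) (U.indicator 1) (tent ((1 / 2) ^ n)) (tent ((1 / 2) ^ n)) p)
    (hK : ∀ n : ℕ, incidence ν μ (U.indicator 1) ((1 / 2) ^ n) ≤ K) :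
    ENNReal.ofReal a * (ν.prod μ) B ≤ ENNReal.ofReal K := by
  have hr : ∀ n : ℕ, (0 : ℝ) < (1 / 2) ^ n := fun n => by positivity
  set F : ℕ → Plane × Plane → ℝ := fun n =>
    arcCorr (fun _ => 1) (U.indicator 1) (tent ((1 / 2) ^ n)) (tent ((1 / 2) ^ n)) with hF
  have hint : ∀ n, Integrable (F n) (ν.prod μ) := fun n =>
    (integral_slice_mul_slice (continuous_tent _) (integrable_tent (hr n)) (continuous_tent _)
      (abs_tent_le (hr n)) measurable_const (measurable_one.indicator hU) (by simp)
      (abs_indicator_one_le U)).2.1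
  calc ENNReal.ofReal a * (ν.prod μ) B = ∫⁻ p in B, ENNReal.ofReal a ∂(ν.prod μ) := by simp
    _ ≤ ∫⁻ p in B, Filter.liminf (fun n => ENNReal.ofReal (F n p)) Filter.atTop ∂(ν.prod μ) := by
        refine setLIntegral_mono' hB fun p hp => ?_
        exact Filter.le_liminf_of_le (by isBoundedDefault)
          ((hle p hp).mono fun n hn => ENNReal.ofReal_le_ofReal hn)
    _ ≤ ∫⁻ p, Filter.liminf (fun n => ENNReal.ofReal (F n p)) Filter.atTop ∂(ν.prod μ) :=
        setLIntegral_le_lintegral _ _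
    _ ≤ Filter.liminf (fun n => ∫⁻ p, ENNReal.ofReal (F n p) ∂(ν.prod μ)) Filter.atTop :=
        lintegral_liminf_le' fun n => (hint n).aemeasurable.ennreal_ofReal
    _ ≤ Filter.liminf (fun _ : ℕ => ENNReal.ofReal K) Filter.atTop := by
        refine Filter.liminf_le_liminf (Filter.Eventually.of_forall fun n => ?_)
        rw [← ofReal_integral_eq_lintegral_ofReal (hint n)
          (ae_of_all _ (arcCorr_tent_nonneg (hr n)))]
        exact ENNReal.ofReal_le_ofReal (hK n)
    _ = _ := Filter.liminf_const _

theorem exists_incidence_pow_le {ν μ : Measure Plane} [IsProbabilityMeasure ν] [IsFiniteMeasure μ]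
    {s u : ℝ} (hs0 : 0 < s) (hs : s < 1) (hu0 : 0 < u) (hu : u ≤ 2) (hsu : 2 < s + u)
    (hμ : energy s μ ≠ ⊤) (hν : energy u ν ≠ ⊤) {K : ℝ} (hK : 0 < K) :
    ∃ δ : ℝ, 0 < δ ∧ ∀ U : Set (Plane × ℝ), MeasurableSet U →
      (μ.prod arc) U < ENNReal.ofReal δ → ∀ n : ℕ,
        incidence ν μ (U.indicator 1) ((1 / 2) ^ n) ≤ K := by
  have hq1 : (1 / 2 : ℝ) ^ ((u + s - 2) / 2) < 1 :=
    Real.rpow_lt_one (by norm_num) (by norm_num) (by linarith)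
  set T := (1 - (1 / 2 : ℝ) ^ ((u + s - 2) / 2))⁻¹ with hT
  have hT0 : 0 < T := inv_pos.2 (by linarith)
  set E := (energy u ν).toReal with hE
  have hE0 : 0 ≤ E := ENNReal.toReal_nonneg
  set ε := K / 3 / (T * 1200 * E + 1) with hεdef
  have hε : 0 < ε := by positivity
  have hη : 0 < K / 3 / (18 * T * ε⁻¹) := by positivity
  have hfin := lintegral_projPotential_ne_top hs0 hs hμ
  obtain ⟨δ, hδ, h⟩ := exists_pos_setLIntegral_lt_of_measure_lt hfin
    (ENNReal.ofReal_pos.2 hη).ne'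
  obtain ⟨δ', hδ'0, hδ'⟩ := ENNReal.lt_iff_exists_nnreal_btwn.1 hδ
  refine ⟨min δ' (K / 6), lt_min (by simpa using hδ'0) (by positivity), fun U hU hm n => ?_⟩
  rw [ENNReal.ofReal_min, lt_min_iff, ENNReal.ofReal_coe_nnreal] at hm
  have hI := h U (hm.1.trans hδ')
  refine (incidence_pow_le hs0 hs.le hu0 hu hsu hε hν hU hI.ne_top n).trans ?_
  set I := (∫⁻ q in U, projPotential s μ q ∂(μ.prod arc)).toReal
  have h1 : ((μ.prod arc) U).toReal ≤ K / 6 :=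
    ENNReal.toReal_le_of_le_ofReal (by positivity) hm.2.le
  have h2 : I ≤ K / 3 / (18 * T * ε⁻¹) := ENNReal.toReal_le_of_le_ofReal hη.le hI.le
  have h3 : ε * (T * 1200 * E) ≤ K / 3 := by
    rw [hεdef, div_mul_eq_mul_div, div_le_iff₀ (by positivity)]
    nlinarith
  rw [le_div_iff₀ (by positivity)] at h2
  nlinarith

theorem norm_sub_le_two {x y : Plane} (hx : ∀ i, 0 ≤ x i ∧ x i < 1)
    (hy : ∀ i, 0 ≤ y i ∧ y i < 1) : ‖y - x‖ ≤ 2 := by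
  rw [EuclideanSpace.norm_eq, Real.sqrt_le_iff]
  refine ⟨by norm_num, ?_⟩
  simp only [Fin.sum_univ_two, PiLp.sub_apply, Real.norm_eq_abs, sq_abs]
  have h0 := hx 0
  have h1 := hx 1
  have h2 := hy 0
  have h3 := hy 1
  nlinarith

theorem prod_arc_preimage_le {μ : Measure Plane} [SFinite μ] {Θ : Set (Plane × Plane)}
    (hΘ : MeasurableSet Θ) :
    (μ.prod arc) ((fun q : Plane × ℝ => (q.1, dir q.2)) ⁻¹' Θ)
      ≤ ENNReal.ofReal Real.pi * ∫⁻ x, μH[1] {θ : Plane | (x, θ) ∈ Θ} ∂μ := by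
  have hm : Measurable fun q : Plane × ℝ => (q.1, dir q.2) :=
    measurable_fst.prodMk (measurable_dir.comp measurable_snd)
  rw [Measure.prod_apply (hm hΘ), ← lintegral_const_mul' _ _ ENNReal.ofReal_ne_top]
  exact lintegral_mono fun x => arc_preimage_dir_le (measurable_prodMk_left hΘ)

theorem exists_incidence_exponents {s u : ℝ} (hs : 0 < s) (hu : max 1 (2 - s) < u) :
    ∃ s' u' : ℝ, 0 < s' ∧ s' < 1 ∧ s' ≤ s ∧ 0 < u' ∧ u' ≤ 2 ∧ u' ≤ u ∧ 2 < s' + u' := by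
  obtain ⟨h1, h2⟩ := max_lt_iff.1 hu
  have hu1 : 1 < min u 2 := lt_min h1 (by norm_num)
  have hu2 : 2 - s < min u 2 := lt_min h2 (by linarith)
  have hu3 := min_le_right u 2
  rcases lt_or_ge s 1 with h | h
  · exact ⟨s, min u 2, hs, h, le_rfl, by linarith, hu3, min_le_left _ _, by linarith⟩
  · exact ⟨(3 - min u 2) / 2, min u 2, by linarith, by linarith, by linarith, by linarith, hu3,
      min_le_left _ _, by linarith⟩

/-- **Proposition (radial projections).** Let `μ, ν` be Borel probability measures on
`[0,1)²` with disjoint supports, `E_s(μ) < ∞`, `E_u(ν) < ∞` for some `s ∈ (0,2)` and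
`u > max(1, 2-s)`. Then there is `κ > 0` such that for every Borel `Θ ⊆ [0,1)² × S¹` with
`(μ × H¹)(Θ) ≤ κ` one has `(μ × ν){(x,y) : P_y(x) ∉ Θ_x} > 2/3`, where
`P_y(x) = (y-x)/|y-x|`. -/
theorem statement9 (μ ν : Measure (EuclideanSpace ℝ (Fin 2)))
    (hμ : IsProbabilityMeasure μ) (hν : IsProbabilityMeasure ν)
    (hμsupp : μ {x : EuclideanSpace ℝ (Fin 2) | ∀ i, 0 ≤ x i ∧ x i < 1}ᶜ = 0)
    (hνsupp : ν {x : EuclideanSpace ℝ (Fin 2) | ∀ i, 0 ≤ x i ∧ x i < 1}ᶜ = 0)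
    (hdisj : Disjoint (msupport μ) (msupport ν))
    (s u : ℝ) (hs : s ∈ Set.Ioo (0 : ℝ) 2) (hu : max 1 (2 - s) < u)
    (hEs : energy s μ ≠ ⊤) (hEu : energy u ν ≠ ⊤) :
    ∃ κ : ℝ, 0 < κ ∧
      ∀ Θ : Set (EuclideanSpace ℝ (Fin 2) × EuclideanSpace ℝ (Fin 2)),
        MeasurableSet Θ →
        Θ ⊆ {x : EuclideanSpace ℝ (Fin 2) | ∀ i, 0 ≤ x i ∧ x i < 1} ×ˢ
          Metric.sphere (0 : EuclideanSpace ℝ (Fin 2)) 1 →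
        (∫⁻ x, μH[1] {θ : EuclideanSpace ℝ (Fin 2) | (x, θ) ∈ Θ} ∂μ) ≤ ENNReal.ofReal κ →
        (2 / 3 : ℝ≥0∞) <
          (μ.prod ν) {p : EuclideanSpace ℝ (Fin 2) × EuclideanSpace ℝ (Fin 2) |
            (p.1, ‖p.2 - p.1‖⁻¹ • (p.2 - p.1)) ∉ Θ} := by
  have hpi := Real.pi_pos
  obtain ⟨s', u', hs0, hs1, hss, hu0, hu2, huu, hsu⟩ := exists_incidence_exponents hs.1 hu
  obtain ⟨δ, hδ, hinc⟩ := exists_incidence_pow_le (ν := ν) (μ := μ) hs0 hs1 hu0 hu2 hsu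
    (energy_ne_top_of_le hs0.le hss hEs) (energy_ne_top_of_le hu0.le huu hEu)
    (by norm_num : (0 : ℝ) < 1 / 256)
  refine ⟨δ / 2 / Real.pi, by positivity, fun Θ hΘ hsub hκ => ?_⟩
  have hsmall : (μ.prod arc) ((fun q : Plane × ℝ => (q.1, dir q.2)) ⁻¹' Θ) < ENNReal.ofReal δ := by
    refine (prod_arc_preimage_le hΘ).trans_lt ((mul_le_mul_right hκ _).trans_lt ?_)
    rw [← ENNReal.ofReal_mul hpi.le, ENNReal.ofReal_lt_ofReal_iff hδ]
    field_simp
    norm_num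
  obtain ⟨U, hΘU, hU, hUδ⟩ := Set.exists_isOpen_lt_of_lt _ _ hsmall
  have hdirm : Measurable fun p : Plane × Plane => (p.1, ‖p.2 - p.1‖⁻¹ • (p.2 - p.1)) := by fun_prop
  set A : Set (Plane × Plane) := {p | (p.1, ‖p.2 - p.1‖⁻¹ • (p.2 - p.1)) ∈ Θ} with hA
  have hAm : MeasurableSet A := hdirm hΘ
  have hνm : MeasurableSet {x : Plane | ∀ i, 0 ≤ x i ∧ x i < 1} := by
    simp only [Set.ofPred_forall]
    exact MeasurableSet.iInter fun i =>
      (by fun_prop : Measurable fun x : Plane => x i) measurableSet_Ico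
  set B : Set (Plane × Plane) :=
    Prod.swap ⁻¹' A ∩ Prod.fst ⁻¹' {x : Plane | ∀ i, 0 ≤ x i ∧ x i < 1} with hB
  have hBm : MeasurableSet B := (measurable_swap hAm).inter (measurable_fst hνm)
  have hAB : (μ.prod ν) A = (ν.prod μ) B := by
    rw [← Measure.prod_swap, Measure.map_apply measurable_swap hAm]
    refine (measure_inter_conull' ?_).symm
    refine measure_mono_null (Set.sdiff_subset_compl _ _) ?_
    rw [← Set.preimage_compl, ← Set.prod_univ, Measure.prod_prod, hνsupp, zero_mul]
  have hBle := measure_le_of_eventually_le_arcCorr hU.measurableSet hBm (a := 3 / 128)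
    (fun p hp => ?_) (hinc U hU.measurableSet hUδ)
  · change _ < (μ.prod ν) Aᶜ
    rw [← hAB, ← ofReal_measureReal, ← ENNReal.ofReal_mul (by norm_num),
      ENNReal.ofReal_le_ofReal_iff (by norm_num)] at hBle
    rw [← ofReal_measureReal, probReal_compl_eq_one_sub hAm,
      show (2 / 3 : ℝ≥0∞) = ENNReal.ofReal (2 / 3) by
        rw [ENNReal.ofReal_div_of_pos (by norm_num)]; simp]
    exact (ENNReal.ofReal_lt_ofReal_iff_of_nonneg (by norm_num)).2 (by linarith)
  · obtain ⟨hpA, hpy⟩ := hp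
    have hp := hsub hpA
    simp only [Prod.fst_swap, Prod.snd_swap] at hp
    obtain ⟨θ₀, hθ₀, hpol⟩ := exists_polar (p.1 - p.2)
    refine eventually_le_arcCorr hU hθ₀ hpol (norm_sub_le_two hp.1 hpy) (hΘU ?_)
    have hne : ‖p.1 - p.2‖ ≠ 0 := by
      intro h0
      have := hp.2
      simp [norm_eq_zero.1 h0] at this
    have hd : ‖p.1 - p.2‖⁻¹ • (p.1 - p.2) = dir θ₀ := by
      nth_rewrite 2 [hpol]
      rw [smul_smul, inv_mul_cancel₀ hne, one_smul]
    change (p.2, dir θ₀) ∈ Θ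
    rw [← hd]
    exact hpA
end

section
/- Let a > 0 and −1 ≤ D < C ≤ 1 with C ≥ 2D. Let f : [0,a] → ℝ be a 1-Lipschitz function such that Dx ≤ f(x) ≤ Cx for every x ∈ [0,a]. Then T(f) ≤ (a − f(a))(C − 2D)/(1 + 2C − 3D) ≤ a·(1−D)(C−2D)/(1+2C−3D). -/
open Set

/-- A good partition of `[0,a]`: a strictly decreasing sequence `a = a₀ > a₁ > … > 0`
tending to `0` with `a_{n-1}/a_n ≤ 2`. -/
def IsGoodPartition (a : ℝ) (u : ℕ → ℝ) : Prop :=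
  u 0 = a ∧ (∀ n, 0 < u n) ∧ (∀ n, u (n + 1) < u n) ∧
    Filter.Tendsto u Filter.atTop (nhds 0) ∧ ∀ n, u n ≤ 2 * u (n + 1)

/-- A `τ`-good partition: a good partition with `a_{n-1}/a_n ≥ 1 + τ`. -/
def IsTauGoodPartition (τ a : ℝ) (u : ℕ → ℝ) : Prop :=
  IsGoodPartition a u ∧ ∀ n, (1 + τ) * u (n + 1) ≤ u n

/-- The total drop of `f` according to the partition `(a_n)`:
`T(f,(a_n)) = Σ_{n≥1} (f(a_n) − min_{[a_n, a_{n-1}]} f)`. -/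
noncomputable def totalDrop (f : ℝ → ℝ) (u : ℕ → ℝ) : ℝ :=
  ∑' n : ℕ, (f (u (n + 1)) - sInf (f '' Set.Icc (u (n + 1)) (u n)))

/-- `T(f)`: the infimum of the total drop over all good partitions of `[0,a]`. -/
noncomputable def drop (a : ℝ) (f : ℝ → ℝ) : ℝ :=
  sInf {t | ∃ u, IsGoodPartition a u ∧ t = totalDrop f u}

/-- `T_τ(f)`: the infimum of the total drop over all `τ`-good partitions of `[0,a]`. -/
noncomputable def dropTau (τ a : ℝ) (f : ℝ → ℝ) : ℝ :=
  sInf {t | ∃ u, IsTauGoodPartition τ a u ∧ t = totalDrop f u}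

/-- Some good partition of `[0,x]` has summable drops, with total at most `c`. -/
def HasDropLE (f : ℝ → ℝ) (x c : ℝ) : Prop :=
  ∃ u, IsGoodPartition x u ∧
    Summable (fun n : ℕ => f (u (n + 1)) - sInf (f '' Set.Icc (u (n + 1)) (u n))) ∧
    totalDrop f u ≤ c

lemma HasDropLE.mono {f : ℝ → ℝ} {x c d : ℝ} (h : HasDropLE f x c) (hcd : c ≤ d) :
    HasDropLE f x d :=
  let ⟨u, hu, hs, ht⟩ := h
  ⟨u, hu, hs, ht.trans hcd⟩

lemma sub_sInf_image_le {f : ℝ → ℝ} {p q d : ℝ} (hpq : p ≤ q)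
    (h : ∀ t ∈ Icc p q, f p - d ≤ f t) : f p - sInf (f '' Icc p q) ≤ d := by
  have : f p - d ≤ sInf (f '' Icc p q) := by
    refine le_csInf ((nonempty_Icc.2 hpq).image f) ?_
    rintro _ ⟨t, ht, rfl⟩
    exact h t ht
  linarith

lemma sub_sInf_image_nonneg {f : ℝ → ℝ} {p q : ℝ} (hpq : p ≤ q)
    (hf : ContinuousOn f (Icc p q)) : 0 ≤ f p - sInf (f '' Icc p q) :=
  sub_nonneg.2 <| csInf_le (isCompact_Icc.bddBelow_image hf)
    (mem_image_of_mem f (left_mem_Icc.2 hpq))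

lemma IsGoodPartition.le {a : ℝ} {u : ℕ → ℝ} (hu : IsGoodPartition a u) (n : ℕ) : u n ≤ a :=
  hu.1 ▸ antitone_nat_of_succ_le (fun k => (hu.2.2.1 k).le) (Nat.zero_le n)

lemma IsGoodPartition.sub_sInf_nonneg {a : ℝ} {f : ℝ → ℝ} {u : ℕ → ℝ}
    (hf : ContinuousOn f (Icc 0 a)) (hu : IsGoodPartition a u) (n : ℕ) :
    0 ≤ f (u (n + 1)) - sInf (f '' Icc (u (n + 1)) (u n)) :=
  sub_sInf_image_nonneg (hu.2.2.1 n).le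
    (hf.mono (Icc_subset_Icc (hu.2.1 _).le (hu.le n)))

lemma HasDropLE.drop_le {a c : ℝ} {f : ℝ → ℝ} (hf : ContinuousOn f (Icc 0 a))
    (h : HasDropLE f a c) : drop a f ≤ c := by
  obtain ⟨u, hu, -, hc⟩ := h
  refine le_trans (csInf_le ⟨0, ?_⟩ ⟨u, hu, rfl⟩) hc
  rintro _ ⟨v, hv, rfl⟩
  exact tsum_nonneg (hv.sub_sInf_nonneg hf)

/-- A good partition of `[0,q]` extends to one of `[0,p]` when `q < p ≤ 2 * q`. -/
lemma HasDropLE.step {f : ℝ → ℝ} {p q c d : ℝ} (h : HasDropLE f q c) (hq : 0 < q)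
    (hqp : q < p) (hp : p ≤ 2 * q) (hd : ∀ t ∈ Icc q p, f q - d ≤ f t) :
    HasDropLE f p (c + d) := by
  obtain ⟨u, ⟨h0, hpos, hlt, hlim, hdbl⟩, hs, hc⟩ := h
  let v : ℕ → ℝ := fun n => Nat.casesOn n p u
  have hs' : Summable (fun n : ℕ => f (v (n + 1)) - sInf (f '' Icc (v (n + 1)) (v n))) :=
    (summable_nat_add_iff 1).1 hs
  refine ⟨v, ⟨rfl, ?_, ?_, (Filter.tendsto_add_atTop_iff_nat 1).1 hlim, ?_⟩, hs', ?_⟩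
  · rintro (_ | n)
    · exact hq.trans hqp
    · exact hpos n
  · rintro (_ | n)
    · change u 0 < p
      rwa [h0]
    · exact hlt n
  · rintro (_ | n)
    · change p ≤ 2 * u 0
      rwa [h0]
    · exact hdbl n
  · have hfirst := sub_sInf_image_le hqp.le hd
    rw [totalDrop, hs'.tsum_eq_zero_add]
    change f (u 0) - sInf (f '' Icc (u 0) p) + totalDrop f u ≤ c + d
    rw [h0]
    linarith

lemma LipschitzOnWith.sub_le_abs {f : ℝ → ℝ} {s : Set ℝ} (hf : LipschitzOnWith 1 f s)
    {p q : ℝ} (hp : p ∈ s) (hq : q ∈ s) : f p - f q ≤ |p - q| := by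
  have := hf.dist_le_mul p hp q hq
  rw [Real.dist_eq, Real.dist_eq, NNReal.coe_one, one_mul] at this
  exact (le_abs_self _).trans this

/-- Repeated halving gives total drop at most `x`. -/
lemma LipschitzOnWith.hasDropLE_self {a x : ℝ} {f : ℝ → ℝ}
    (hf : LipschitzOnWith 1 f (Icc 0 a)) (hx : 0 < x) (hxa : x ≤ a) : HasDropLE f x x := by
  let u : ℕ → ℝ := fun n => x / 2 ^ n
  have hhalf : ∀ n, u n = 2 * u (n + 1) := fun n => by
    simp only [u, pow_succ]
    field_simp
  have hpos : ∀ n, 0 < u n := fun n => by positivity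
  have hu : IsGoodPartition x u := by
    refine ⟨by simp [u], hpos, fun n => ?_, ?_, fun n => (hhalf n).le⟩
    · linarith [hhalf n, hpos (n + 1)]
    · have := (tendsto_pow_atTop_nhds_zero_of_lt_one (r := (1 / 2 : ℝ))
        (by norm_num) (by norm_num)).const_mul x
      simpa [u, div_eq_mul_inv] using this
  have hle : ∀ n, f (u (n + 1)) - sInf (f '' Icc (u (n + 1)) (u n)) ≤ x / 2 / 2 ^ n := by
    intro n
    have hun : x / 2 / 2 ^ n = u (n + 1) := by
      simp only [u, pow_succ]
      field_simp
    rw [hun]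
    refine sub_sInf_image_le (hu.2.2.1 n).le fun t ht => ?_
    have h1 := hf.sub_le_abs (p := u (n + 1)) (q := t)
      ⟨(hpos _).le, (hu.le _).trans hxa⟩
      ⟨(hpos _).le.trans ht.1, ht.2.trans ((hu.le n).trans hxa)⟩
    rw [abs_of_nonpos (by linarith [ht.1])] at h1
    linarith [ht.2, hhalf n]
  have hgeo := hasSum_geometric_two' x
  have hnn := hu.sub_sInf_nonneg (hf.continuousOn.mono (Icc_subset_Icc_right hxa))
  have hs := Summable.of_nonneg_of_le hnn hle hgeo.summable
  exact ⟨u, hu, hs, (hs.tsum_le_tsum hle hgeo.summable).trans hgeo.tsum_eq.le⟩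

lemma isCompact_argmin {f : ℝ → ℝ} {p q : ℝ} (hf : ContinuousOn f (Icc p q)) :
    IsCompact {s ∈ Icc p q | ∀ t ∈ Icc p q, f s ≤ f t} := by
  refine isCompact_Icc.of_isClosed_subset ?_ (sep_subset _ _)
  have : {s ∈ Icc p q | ∀ t ∈ Icc p q, f s ≤ f t} =
      Icc p q ∩ ⋂ t ∈ Icc p q, Icc p q ∩ f ⁻¹' Iic (f t) := by
    ext s
    simp only [mem_ofPred_eq, mem_inter_iff, mem_iInter, mem_preimage, mem_Iic]
    exact ⟨fun h => ⟨h.1, fun t ht => ⟨h.1, h.2 t ht⟩⟩,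
      fun h => ⟨h.1, fun t ht => (h.2 t ht).2⟩⟩
  rw [this]
  exact isClosed_Icc.inter (isClosed_biInter fun t _ =>
    hf.preimage_isClosed_of_isClosed isClosed_Icc isClosed_Iic)

lemma argmin_nonempty {f : ℝ → ℝ} {p q : ℝ} (hpq : p ≤ q) (hf : ContinuousOn f (Icc p q)) :
    {s ∈ Icc p q | ∀ t ∈ Icc p q, f s ≤ f t}.Nonempty :=
  let ⟨s, hs, h⟩ := isCompact_Icc.exists_isMinOn (nonempty_Icc.2 hpq) hf
  ⟨s, hs, fun _ ht => h ht⟩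

lemma exists_rightmost_argmin {f : ℝ → ℝ} {p q : ℝ} (hpq : p ≤ q)
    (hf : ContinuousOn f (Icc p q)) :
    ∃ s ∈ Icc p q, (∀ t ∈ Icc p q, f s ≤ f t) ∧ ∀ t ∈ Icc p q, f t ≤ f s → t ≤ s := by
  obtain ⟨s, hs, hmax⟩ := (isCompact_argmin hf).exists_isGreatest (argmin_nonempty hpq hf)
  exact ⟨s, hs.1, hs.2, fun t ht hts => hmax ⟨ht, fun r hr => hts.trans (hs.2 r hr)⟩⟩

lemma exists_leftmost_argmin {f : ℝ → ℝ} {p q : ℝ} (hpq : p ≤ q)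
    (hf : ContinuousOn f (Icc p q)) :
    ∃ s ∈ Icc p q, (∀ t ∈ Icc p q, f s ≤ f t) ∧ ∀ t ∈ Icc p q, f t ≤ f s → s ≤ t := by
  obtain ⟨s, hs, hmin⟩ := (isCompact_argmin hf).exists_isLeast (argmin_nonempty hpq hf)
  exact ⟨s, hs.1, hs.2, fun t ht hts => hmin ⟨ht, fun r hr => hts.trans (hs.2 r hr)⟩⟩

/-- If `f x` is minimal on `[x/2,x]` and every `s ∈ [q,x/2)` has a point of `(s,2s]` at which `f`
is at most `f s`, then going from `x` down to `q` costs at most `f q - f x`. -/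
lemma HasDropLE.of_no_strict_min {f : ℝ → ℝ} {x : ℝ} (hx : 0 < x)
    (hf : ContinuousOn f (Icc 0 x)) (hmin : ∀ t ∈ Icc (x / 2) x, f x ≤ f t) (n : ℕ) :
    ∀ {q c : ℝ}, 0 < q → q ≤ x → x ≤ 2 ^ n * q →
      (∀ s ∈ Ico q (x / 2), ∃ t ∈ Ioc s (2 * s), f t ≤ f s) →
      HasDropLE f q c → HasDropLE f x (c + (f q - f x)) := by
  have hlast : ∀ {q c : ℝ}, q ≤ x → x / 2 ≤ q → HasDropLE f q c →
      HasDropLE f x (c + (f q - f x)) := by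
    intro q c hqx hxq h
    rcases hqx.eq_or_lt with rfl | hlt
    · simpa using h
    · exact h.step (by linarith) hlt (by linarith) fun t ht => by
        linarith [hmin t ⟨hxq.trans ht.1, ht.2⟩]
  have hup : ∀ {q c : ℝ}, 0 < q → q < x / 2 → (∃ t ∈ Ioc q (2 * q), f t ≤ f q) →
      HasDropLE f q c → ∃ s ∈ Ioc q (2 * q), f s ≤ f q ∧
        (∀ t ∈ Icc q (2 * q), f t ≤ f s → t ≤ s) ∧ HasDropLE f s (c + (f q - f s)) := by
    rintro q c hq hqx ⟨t, ht, hft⟩ h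
    obtain ⟨s, hs, hsmin, hsmax⟩ := exists_rightmost_argmin (f := f) (p := q) (q := 2 * q)
      (by linarith) (hf.mono (Icc_subset_Icc hq.le (by linarith)))
    have hfs : f s ≤ f q := hsmin q ⟨le_rfl, by linarith⟩
    have hqs : q < s := by
      rcases hs.1.eq_or_lt with rfl | hlt
      · exact absurd (hsmax t ⟨ht.1.le, ht.2⟩ hft) (not_le.2 ht.1)
      · exact hlt
    exact ⟨s, ⟨hqs, hs.2⟩, hfs, hsmax, h.step hq hqs hs.2 fun r hr => by
      linarith [hsmin r ⟨hr.1, hr.2.trans hs.2⟩]⟩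
  induction n with
  | zero =>
    intro q c _ hqx hxq _ h
    exact hlast hqx (by linarith) h
  | succ n ih =>
    intro q c hq hqx hxq hns h
    rcases le_or_gt (x / 2) q with hle | hlt
    · exact hlast hqx hle h
    obtain ⟨s, hs, hfs, hsmax, h₁⟩ := hup hq hlt (hns q ⟨le_rfl, hlt⟩) h
    rcases le_or_gt (x / 2) s with hle' | hlt'
    · exact (hlast (by linarith [hs.2]) hle' h₁).mono (by linarith)
    have hs0 : 0 < s := hq.trans hs.1
    obtain ⟨r, hr, hfr, -, h₂⟩ := hup hs0 hlt' (hns s ⟨hs.1.le, hlt'⟩) h₁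
    have hqr : 2 * q < r := by
      by_contra! hle'
      exact absurd (hsmax r ⟨by linarith [hr.1, hs.1], hle'⟩ hfr) (not_le.2 hr.1)
    refine (ih (by linarith) (by linarith [hr.2]) ?_ (fun t ht =>
      hns t ⟨by linarith [ht.1], ht.2⟩) h₂).mono (by linarith)
    rw [pow_succ] at hxq
    nlinarith [pow_pos (two_pos : (0 : ℝ) < 2) n]

/-- From a point `x` at which `f` is minimal on `[x/2,x]` one can descend to some `q ≤ x/2`
paying at most `K` times the decrease of `t - f t`, up to an arbitrarily small error. -/
lemma exists_descent {a C D K x δ : ℝ} {f : ℝ → ℝ} (hDC : D ≤ C) (hK0 : 0 ≤ K) (hK1 : K ≤ 1)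
    (hK : K * (1 + 2 * C - 3 * D) = C - 2 * D) (hN : 0 < 1 + 2 * C - 3 * D)
    (hf : LipschitzOnWith 1 f (Icc 0 a))
    (hbd : ∀ t ∈ Icc (0 : ℝ) a, D * t ≤ f t ∧ f t ≤ C * t) (hx : 0 < x) (hxa : x ≤ a)
    (hmin : ∀ t ∈ Icc (x / 2) x, f x ≤ f t) (hδ : 0 < δ) :
    ∃ q, 0 < q ∧ q ≤ x / 2 ∧ f q - f x + K * (q - f q) ≤ K * (x - f x) + δ ∧
      ∀ c, HasDropLE f q c → HasDropLE f x (c + (f q - f x)) := by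
  let S : Set ℝ := insert 0 {s ∈ Ioo 0 (x / 2) | ∀ t ∈ Ioc s (2 * s), f s < f t}
  have hS : ∀ s ∈ S, 0 ≤ s ∧ s ≤ x / 2 ∧ f s ≤ f (2 * s) := by
    rintro s (rfl | ⟨hs, hst⟩)
    · exact ⟨le_rfl, by linarith, by simp⟩
    · exact ⟨hs.1.le, hs.2.le, (hst (2 * s) ⟨by linarith [hs.1], le_rfl⟩).le⟩
  have hSne : S.Nonempty := ⟨0, mem_insert _ _⟩
  have hSbdd : BddAbove S := ⟨x / 2, fun s hs => (hS s hs).2.1⟩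
  obtain ⟨y, hy⟩ : ∃ y, y = sSup S := ⟨_, rfl⟩
  have hy0 : 0 ≤ y := hy ▸ le_csSup hSbdd (mem_insert _ _)
  have hyx : y ≤ x / 2 := hy ▸ csSup_le hSne fun s hs => (hS s hs).2.1
  have hlip : ∀ {p q : ℝ}, 0 ≤ p → p ≤ q → q ≤ a → f p - f q ≤ q - p ∧ f q - f p ≤ q - p := by
    intro p q hp hpq hq
    have h1 := hf.sub_le_abs (p := p) (q := q) ⟨hp, hpq.trans hq⟩ ⟨hp.trans hpq, hq⟩
    have h2 := hf.sub_le_abs (p := q) (q := p) ⟨hp.trans hpq, hq⟩ ⟨hp, hpq.trans hq⟩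
    rw [abs_of_nonpos (by linarith)] at h1
    rw [abs_of_nonneg (by linarith)] at h2
    exact ⟨by linarith, h2⟩
  have hy2 : f y ≤ f (2 * y) := by
    refine le_of_forall_pos_le_add fun e he => ?_
    obtain ⟨s, hs, hlt⟩ := exists_lt_of_lt_csSup hSne (show y - e / 3 < sSup S by linarith)
    obtain ⟨hs0, -, hfs⟩ := hS s hs
    have hsy : s ≤ y := hy ▸ le_csSup hSbdd hs
    have h1 := (hlip hs0 hsy (by linarith)).2
    have h2 := (hlip (p := 2 * s) (q := 2 * y) (by linarith) (by linarith) (by linarith)).1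
    linarith
  have hkey : f y - f x + K * (y - f y) ≤ K * (x - f x) := by
    have h1 := (hlip (p := 2 * y) (q := x) (by linarith) (by linarith) hxa).2
    have h1' := (hlip (p := 2 * y) (q := x) (by linarith) (by linarith) hxa).1
    have h2 := (hbd y ⟨hy0, by linarith⟩).2
    have h3 := (hbd x ⟨hx.le, hxa⟩).1
    have h4 := mul_nonneg (sub_nonneg.2 hDC)
      (show 0 ≤ x - 2 * y - (f y - f x) by linarith)
    refine le_of_mul_le_mul_left ?_ hN
    have h5 : (1 + 2 * C - 3 * D) * (K * (x - f x) - K * (y - f y)) =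
        (C - 2 * D) * ((x - f x) - (y - f y)) := by
      rw [← hK]
      ring
    nlinarith
  obtain ⟨η, hη⟩ : ∃ η, η = min (δ / 3) (x / 2 - y) := ⟨_, rfl⟩
  have hη0 : 0 ≤ η := hη ▸ le_min (by linarith) (by linarith)
  have hηδ : η ≤ δ / 3 := hη ▸ min_le_left _ _
  have hηx : η ≤ x / 2 - y := hη ▸ min_le_right _ _
  have hη' : 0 < η ∨ y = x / 2 := by
    rcases hyx.eq_or_lt with h | h
    · exact Or.inr h
    · exact Or.inl (hη ▸ lt_min (by linarith) (by linarith))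
  have hq0 : 0 < y + η := by
    rcases hη' with h | h <;> linarith
  refine ⟨y + η, hq0, by linarith, ?_, fun c hc => ?_⟩
  · obtain ⟨h1, h2⟩ := hlip hy0 (show y ≤ y + η by linarith) (by linarith)
    have h3 := mul_le_mul_of_nonneg_left
      (show (y + η - f (y + η)) - (y - f y) ≤ 2 * η by linarith) hK0
    have h4 := mul_le_mul_of_nonneg_right hK1 (show 0 ≤ 2 * η by linarith)
    linarith
  · obtain ⟨n, hn⟩ := pow_unbounded_of_one_lt (x / (y + η)) (one_lt_two : (1 : ℝ) < 2)
    refine hc.of_no_strict_min hx (hf.continuousOn.mono (Icc_subset_Icc_right hxa)) hmin n hq0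
      (by linarith) ((div_lt_iff₀ hq0).1 hn).le fun s hs => ?_
    by_contra! hcon
    have hsS : s ∈ S := Or.inr ⟨⟨hq0.trans_le hs.1, hs.2⟩, hcon⟩
    have hsy : s ≤ y := hy ▸ le_csSup hSbdd hsS
    rcases hη' with h | h <;> linarith [hs.1, hs.2]

lemma hasDropLE_of_le_two_pow {a C D K e : ℝ} {f : ℝ → ℝ} (hDC : D ≤ C) (hC : C ≤ 1)
    (hK0 : 0 ≤ K) (hK1 : K ≤ 1) (hK : K * (1 + 2 * C - 3 * D) = C - 2 * D)
    (hN : 0 < 1 + 2 * C - 3 * D) (hf : LipschitzOnWith 1 f (Icc 0 a))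
    (hbd : ∀ t ∈ Icc (0 : ℝ) a, D * t ≤ f t ∧ f t ≤ C * t) (n : ℕ) :
    ∀ {x δ : ℝ}, 0 < x → x ≤ a → x ≤ 2 ^ n * e → 0 < δ →
      HasDropLE f x (K * (x - f x) + e + δ) := by
  induction n with
  | zero =>
    intro x δ hx hxa hxe hδ
    have h1 : 0 ≤ x - f x := by
      nlinarith [(hbd x ⟨hx.le, hxa⟩).2]
    exact (hf.hasDropLE_self hx hxa).mono (by nlinarith [mul_nonneg hK0 h1])
  | succ n ih =>
    have hhard : ∀ {x δ : ℝ}, 0 < x → x ≤ a → x ≤ 2 ^ (n + 1) * e → 0 < δ →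
        (∀ t ∈ Icc (x / 2) x, f x ≤ f t) → HasDropLE f x (K * (x - f x) + e + δ) := by
      intro x δ hx hxa hxe hδ hmin
      obtain ⟨q, hq, hqx, hcost, hstep⟩ :=
        exists_descent hDC hK0 hK1 hK hN hf hbd hx hxa hmin (half_pos hδ)
      refine (hstep _ (ih hq (by linarith) ?_ (half_pos hδ))).mono (by linarith)
      rw [pow_succ] at hxe
      linarith
    have hfree : ∀ {p q δ : ℝ}, 0 < q → q < p → p ≤ 2 * q → p ≤ a →
        (∀ t ∈ Icc q p, f q ≤ f t) → HasDropLE f q (K * (q - f q) + e + δ) →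
        HasDropLE f p (K * (p - f p) + e + δ) := by
      intro p q δ hq hqp hp hpa hle h
      have h1 := hf.sub_le_abs (p := p) (q := q) ⟨by linarith, hpa⟩ ⟨hq.le, by linarith⟩
      rw [abs_of_nonneg (by linarith)] at h1
      refine (h.step (d := 0) hq hqp hp (by simpa using hle)).mono ?_
      nlinarith [mul_nonneg hK0 (show 0 ≤ (p - f p) - (q - f q) by linarith)]
    intro x δ hx hxa hxe hδ
    obtain ⟨w, hw, hwmin, hwleft⟩ := exists_leftmost_argmin (f := f) (p := x / 2) (q := x)
      (by linarith) (hf.continuousOn.mono (Icc_subset_Icc (by linarith) hxa))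
    rcases hw.2.eq_or_lt with rfl | hwx
    · exact hhard hx hxa hxe hδ hwmin
    have hw0 : 0 < w := by linarith [hw.1]
    refine hfree hw0 hwx (by linarith [hw.1]) hxa (fun t ht => hwmin t ⟨hw.1.trans ht.1, ht.2⟩) ?_
    obtain ⟨v, hv, hvmin, -⟩ := exists_leftmost_argmin (f := f) (p := w / 2) (q := w)
      (by linarith) (hf.continuousOn.mono (Icc_subset_Icc (by linarith) (by linarith)))
    have hfv : f v ≤ f w := hvmin w ⟨by linarith, le_rfl⟩
    rcases hv.2.eq_or_lt with rfl | hvw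
    · exact hhard hw0 (by linarith) (by linarith) hδ hvmin
    have hv0 : 0 < v := by linarith [hv.1]
    have hvx : v < x / 2 := by
      by_contra! hle
      exact absurd (hwleft v ⟨hle, by linarith⟩ hfv) (not_le.2 hvw)
    refine hfree hv0 hvw (by linarith [hv.1]) (by linarith)
      (fun t ht => hvmin t ⟨hv.1.trans ht.1, ht.2⟩) (ih hv0 (by linarith) ?_ hδ)
    rw [pow_succ] at hxe
    linarith

/-- **Proposition.** Let `a > 0`, `−1 ≤ D < C ≤ 1` with `C ≥ 2D`, and let `f : [0,a] → ℝ` be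
`1`-Lipschitz with `Dx ≤ f(x) ≤ Cx` on `[0,a]`. Then
`T(f) ≤ (a − f(a))(C − 2D)/(1 + 2C − 3D) ≤ a(1−D)(C−2D)/(1+2C−3D)`. -/
theorem statement12 (a C D : ℝ) (ha : 0 < a) (hD : -1 ≤ D) (hDC : D < C) (hC : C ≤ 1)
    (hCD : 2 * D ≤ C) (f : ℝ → ℝ) (hf : LipschitzOnWith 1 f (Set.Icc 0 a))
    (hbd : ∀ x ∈ Set.Icc (0 : ℝ) a, D * x ≤ f x ∧ f x ≤ C * x) :
    drop a f ≤ (a - f a) * (C - 2 * D) / (1 + 2 * C - 3 * D) ∧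
    (a - f a) * (C - 2 * D) / (1 + 2 * C - 3 * D) ≤
      a * ((1 - D) * (C - 2 * D)) / (1 + 2 * C - 3 * D) := by
  have hN : 0 < 1 + 2 * C - 3 * D := by linarith
  have hE : 0 ≤ C - 2 * D := by linarith
  refine ⟨le_of_forall_pos_le_add fun e he => ?_, ?_⟩
  · obtain ⟨K, hKdef⟩ : ∃ K, K = (C - 2 * D) / (1 + 2 * C - 3 * D) := ⟨_, rfl⟩
    have hK0 : 0 ≤ K := hKdef ▸ div_nonneg hE hN.le
    have hK1 : K ≤ 1 := hKdef ▸ (div_le_one hN).2 (by linarith)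
    have hK : K * (1 + 2 * C - 3 * D) = C - 2 * D := by
      rw [hKdef]
      exact div_mul_cancel₀ _ hN.ne'
    obtain ⟨n, hn⟩ := pow_unbounded_of_one_lt (a / (e / 2)) (one_lt_two : (1 : ℝ) < 2)
    have h := hasDropLE_of_le_two_pow hDC.le hC hK0 hK1 hK hN hf hbd n ha le_rfl
      ((div_lt_iff₀ (half_pos he)).1 hn).le (half_pos he)
    refine (h.drop_le hf.continuousOn).trans ?_
    rw [mul_div_assoc, ← hKdef]
    linarith
  · have h1 := (hbd a ⟨ha.le, le_rfl⟩).1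
    refine div_le_div_of_nonneg_right ?_ hN.le
    nlinarith [mul_nonneg hE (show 0 ≤ f a - D * a by linarith)]
end
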